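/- arXiv:1303.0497 — 5 statements merged into one kernel-verified Lean document; each statement's English description precedes it below -/
import Mathlib

section
/- If f ∈ T^b_ε has constant slope ±s for some s > 0, i.e. |f′(x)| = s at every point x where f is differentiable, then the topological entropy of f equals max(log s, 0). -/
/-- Topological entropy of a self-map of `ℝ`, computed on the interval `[-1,1]`. -/
noncomputable def htop (f : ℝ → ℝ) : EReal := Dynamics.coverEntropy f (Set.Icc (-1) 1)

/-- The points `c_i = -1 + 2i/(b+1)`, `i = 0, …, b+1`. -/
noncomputable def cpt (b : ℕ) (i : ℕ) : ℝ := -1 + 2 * i / ((b : ℝ) + 1)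

/-- Extension of the critical-value vector `v : Fin b → ℝ` to indices `0, …, b+1`,
with `v_0 = ε` and `v_{b+1} = (-1)^{b+1} ε`.  Index `i : Fin b` is the paper's `v_{i+1}`. -/
noncomputable def vext (b : ℕ) (ε : ℝ) (v : Fin b → ℝ) : ℕ → ℝ := fun i =>
  if h : 1 ≤ i ∧ i ≤ b then v ⟨i - 1, by omega⟩
  else if i = 0 then ε else (-1) ^ (b + 1) * ε

/-- Admissibility of the critical value vector `v`:
`(v_i - v_{i-1})·ε < 0` for odd `i` and `> 0` for even `i`, `1 ≤ i ≤ b+1`. -/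
def Admissible (b : ℕ) (ε : ℝ) (v : Fin b → ℝ) : Prop :=
  (∀ i, v i ∈ Set.Icc (-1 : ℝ) 1) ∧
  ∀ i : ℕ, 1 ≤ i → i ≤ b + 1 →
    (Odd i → (vext b ε v i - vext b ε v (i - 1)) * ε < 0) ∧
    (Even i → (vext b ε v i - vext b ε v (i - 1)) * ε > 0)

/-- `f` is the `b`-modal tent map with (admissible) critical values `v`, i.e. a member
of `T^b_ε`: it sends `c_i` to `v_i` and is linear (affine) on each `[c_i, c_{i+1}]`. -/
def IsTentMap (b : ℕ) (ε : ℝ) (v : Fin b → ℝ) (f : ℝ → ℝ) : Prop :=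
  Admissible b ε v ∧
  (∀ i : ℕ, i ≤ b + 1 → f (cpt b i) = vext b ε v i) ∧
  ∀ i : ℕ, i ≤ b → ∃ m q : ℝ, ∀ x ∈ Set.Icc (cpt b i) (cpt b (i + 1)), f x = m * x + q

open Set Filter MeasureTheory Dynamics

/-- `g` is affine with slope `±σ` on every subinterval of `[-1,1]` whose interior misses `P`. -/
def AffineOff (g : ℝ → ℝ) (σ : ℝ) (P : Set ℝ) : Prop :=
  ∀ a c, -1 ≤ a → a < c → c ≤ 1 → (∀ p ∈ P, p ∉ Ioo a c) →
    ∃ m q : ℝ, |m| = σ ∧ ∀ x ∈ Icc a c, g x = m * x + q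

/-! ### Upper bound for Lipschitz maps -/

lemma iterate_sub_le {f : ℝ → ℝ} {L : ℝ} (hL : 0 ≤ L) (hmaps : MapsTo f (Icc (-1) 1) (Icc (-1) 1))
    (hlip : ∀ x ∈ Icc (-1 : ℝ) 1, ∀ y ∈ Icc (-1 : ℝ) 1, |f x - f y| ≤ L * |x - y|) (k : ℕ) :
    ∀ x ∈ Icc (-1 : ℝ) 1, ∀ y ∈ Icc (-1 : ℝ) 1, |f^[k] x - f^[k] y| ≤ L ^ k * |x - y| := by
  induction k with
  | zero => simp
  | succ k ih =>
    intro x hx y hy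
    rw [Function.iterate_succ_apply, Function.iterate_succ_apply]
    calc |f^[k] (f x) - f^[k] (f y)| ≤ L ^ k * |f x - f y| := ih _ (hmaps hx) _ (hmaps hy)
      _ ≤ L ^ k * (L * |x - y|) := by gcongr; exact hlip x hx y hy
      _ = L ^ (k + 1) * |x - y| := by ring

/-- Every point of `[-1,1]` is within `h` of a point of a grid of at most `2 / h + 1` points. -/
lemma exists_grid {h : ℝ} (hh : 0 < h) :
    ∃ t : Finset ℝ, (t.card : ℝ) ≤ 2 / h + 1 ∧
      ∀ x ∈ Icc (-1 : ℝ) 1, ∃ y ∈ t, y ∈ Icc (-1 : ℝ) 1 ∧ |x - y| < h := by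
  refine ⟨(Finset.range (⌊2 / h⌋₊ + 1)).image (fun j : ℕ => -1 + j * h), ?_, ?_⟩
  · have h1 : (((Finset.range (⌊2 / h⌋₊ + 1)).image (fun j : ℕ => -1 + j * h)).card : ℝ)
        ≤ ((⌊2 / h⌋₊ + 1 : ℕ) : ℝ) := by
      exact_mod_cast Finset.card_image_le.trans (Finset.card_range _).le
    have h2 := Nat.floor_le (show 0 ≤ 2 / h by positivity)
    push_cast at h1
    linarith
  · intro x hx
    have h0 : 0 ≤ (x + 1) / h := div_nonneg (by linarith [hx.1]) hh.le
    have hlo := Nat.floor_le h0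
    have hhi := Nat.lt_floor_add_one ((x + 1) / h)
    rw [le_div_iff₀ hh] at hlo
    rw [div_lt_iff₀ hh] at hhi
    refine ⟨-1 + ⌊(x + 1) / h⌋₊ * h, Finset.mem_image.2 ⟨⌊(x + 1) / h⌋₊, ?_, rfl⟩, ⟨?_, ?_⟩, ?_⟩
    · rw [Finset.mem_range, Nat.lt_succ_iff]
      apply Nat.floor_le_floor
      gcongr
      linarith [hx.2]
    · have : 0 ≤ (⌊(x + 1) / h⌋₊ : ℝ) * h := by positivity
      linarith
    · linarith [hx.2]
    · rw [abs_lt]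
      constructor <;> linarith

lemma coverEntropy_le_log_of_lipschitz {f : ℝ → ℝ} {L : ℝ} (hL : 1 ≤ L)
    (hmaps : MapsTo f (Icc (-1) 1) (Icc (-1) 1))
    (hlip : ∀ x ∈ Icc (-1 : ℝ) 1, ∀ y ∈ Icc (-1 : ℝ) 1, |f x - f y| ≤ L * |x - y|) :
    coverEntropy f (Icc (-1) 1) ≤ (Real.log L : EReal) := by
  have hL0 : 0 < L := by linarith
  rw [coverEntropy_eq_iSup_basis Metric.uniformity_basis_dist]
  refine iSup₂_le fun η hη => ?_
  rw [← ENNReal.log_ofReal_of_pos hL0, ← ExpGrowth.expGrowthSup_pow]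
  refine ExpGrowth.expGrowthSup_le_of_eventually_le (b := ENNReal.ofReal (2 / η + 1))
    ENNReal.ofReal_ne_top (Eventually.of_forall fun n => ?_)
  have hLn : 1 ≤ L ^ n := one_le_pow₀ hL
  obtain ⟨t, htcard, ht⟩ := exists_grid (h := η / L ^ n) (by positivity)
  have hcover : IsDynCoverOf f (Icc (-1) 1) {p : ℝ × ℝ | dist p.1 p.2 < η} n (t : Set ℝ) := by
    intro x hx
    obtain ⟨y, hyt, hy, hxy⟩ := ht x hx
    refine ⟨y, hyt, mem_dynEntourage.2 fun k hk => ?_⟩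
    rw [mem_ofPred_eq, Real.dist_eq]
    calc |f^[k] x - f^[k] y| ≤ L ^ k * |x - y| := iterate_sub_le hL0.le hmaps hlip k x hx y hy
      _ ≤ L ^ n * |x - y| := by gcongr
      _ < L ^ n * (η / L ^ n) := by gcongr
      _ = η := by field_simp
  calc ((coverMincard f (Icc (-1) 1) {p : ℝ × ℝ | dist p.1 p.2 < η} n : ℕ∞) : ENNReal)
      ≤ ((t.card : ℕ∞) : ENNReal) := ENat.toENNReal_mono hcover.coverMincard_le_card
    _ = ENNReal.ofReal (t.card : ℝ) := by simp
    _ ≤ ENNReal.ofReal ((2 / η + 1) * L ^ n) := by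
      apply ENNReal.ofReal_le_ofReal
      calc (t.card : ℝ) ≤ 2 / (η / L ^ n) + 1 := htcard
        _ = 2 / η * L ^ n + 1 := by field_simp
        _ ≤ (2 / η + 1) * L ^ n := by linarith
    _ = ENNReal.ofReal (2 / η + 1) * ENNReal.ofReal L ^ n := by
      rw [ENNReal.ofReal_mul (by positivity), ENNReal.ofReal_pow hL0.le]

/-! ### Lower bound for piecewise affine maps -/

lemma AffineOff.iterate {f : ℝ → ℝ} {s : ℝ} (hs : 0 < s) {P : Set ℝ} (hP : P.Finite)
    (hf : AffineOff f s P) (hmaps : MapsTo f (Icc (-1) 1) (Icc (-1) 1))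
    (hfib : ∀ y, {x ∈ Icc (-1 : ℝ) 1 | f x = y}.Finite) (N : ℕ) :
    ∃ Q : Set ℝ, Q.Finite ∧ AffineOff f^[N] (s ^ N) Q := by
  induction N with
  | zero => exact ⟨∅, finite_empty, fun a c _ _ _ _ => ⟨1, 0, by simp, by simp⟩⟩
  | succ N ih =>
    obtain ⟨Q, hQ, hfN⟩ := ih
    refine ⟨P ∪ ⋃ y ∈ Q, {x ∈ Icc (-1 : ℝ) 1 | f x = y}, hP.union (hQ.biUnion fun y _ => hfib y),
      fun a c ha hac hc hmiss => ?_⟩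
    obtain ⟨m, q, hm, hmq⟩ := hf a c ha hac hc fun p hp => hmiss p (Or.inl hp)
    have hmiss' : ∀ x ∈ Ioo a c, f x ∉ Q := fun x hx hxQ =>
      hmiss x (Or.inr (mem_biUnion hxQ ⟨⟨by linarith [hx.1], by linarith [hx.2]⟩, rfl⟩)) hx
    have hfa := hmaps (show a ∈ Icc (-1 : ℝ) 1 from ⟨ha, by linarith⟩)
    have hfc := hmaps (show c ∈ Icc (-1 : ℝ) 1 from ⟨by linarith, hc⟩)
    rw [hmq a ⟨le_rfl, hac.le⟩] at hfa
    rw [hmq c ⟨hac.le, le_rfl⟩] at hfc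
    have hm0 : m ≠ 0 := by rintro rfl; simp at hm; linarith
    have himage : ∀ p ∈ Q, (p - q) / m ∉ Ioo a c := fun p hp hmem => by
      apply hmiss' _ hmem
      rw [hmq _ (Ioo_subset_Icc_self hmem), mul_div_cancel₀ _ hm0]
      simpa using hp
    obtain ⟨m', q', hm', hmq'⟩ : ∃ m' q' : ℝ, |m'| = s ^ N ∧
        ∀ x ∈ Icc a c, f^[N] (m * x + q) = m' * (m * x + q) + q' := by
      rcases lt_or_gt_of_ne hm0 with hneg | hpos
      · obtain ⟨m', q', hm', h⟩ := hfN (m * c + q) (m * a + q) hfc.1 (by nlinarith) hfa.2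
          fun p hp hmem => himage p hp
            ⟨by rw [lt_div_iff_of_neg hneg]; linarith [hmem.2],
              by rw [div_lt_iff_of_neg hneg]; linarith [hmem.1]⟩
        exact ⟨m', q', hm', fun x hx => h _ ⟨by nlinarith [hx.2], by nlinarith [hx.1]⟩⟩
      · obtain ⟨m', q', hm', h⟩ := hfN (m * a + q) (m * c + q) hfa.1 (by nlinarith) hfc.2
          fun p hp hmem => himage p hp
            ⟨by rw [lt_div_iff₀ hpos]; linarith [hmem.1],
              by rw [div_lt_iff₀ hpos]; linarith [hmem.2]⟩
        exact ⟨m', q', hm', fun x hx => h _ ⟨by nlinarith [hx.1], by nlinarith [hx.2]⟩⟩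
    refine ⟨m' * m, m' * q + q', by rw [abs_mul, hm, hm', pow_succ], fun x hx => ?_⟩
    rw [Function.iterate_succ_apply, hmq x hx, hmq' x hx]
    ring

lemma Set.Finite.exists_pos_forall_le_abs_sub {P : Set ℝ} (hP : P.Finite) :
    ∃ δ > 0, ∀ x ∈ P, ∀ y ∈ P, x ≠ y → δ ≤ |x - y| := by
  obtain ⟨δ, hδ, hle⟩ := ENNReal.lt_iff_exists_nnreal_btwn.1 hP.einfsep_pos
  refine ⟨δ, by exact_mod_cast hδ, fun x hx y hy hxy => ?_⟩
  have h := le_einfsep_iff.1 hle.le x hx y hy hxy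
  rw [edist_dist, ← ENNReal.ofReal_coe_nnreal, ENNReal.ofReal_le_ofReal_iff dist_nonneg] at h
  rwa [Real.dist_eq] at h

lemma AffineOff.volume_preimage_Icc_le {g : ℝ → ℝ} {σ : ℝ} (hσ : 0 < σ) {P : Set ℝ}
    (hg : AffineOff g σ P) {a c : ℝ} (ha : -1 ≤ a) (hc : c ≤ 1) (hmiss : ∀ p ∈ P, p ∉ Ioo a c)
    (A : Set ℝ) : volume (Icc a c ∩ g ⁻¹' A) ≤ ENNReal.ofReal σ⁻¹ * volume A := by
  rcases lt_or_ge a c with hac | hca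
  · obtain ⟨m, q, hm, hmq⟩ := hg a c ha hac hc hmiss
    have hm0 : m ≠ 0 := by rintro rfl; simp at hm; linarith
    calc volume (Icc a c ∩ g ⁻¹' A) ≤ volume ((m * ·) ⁻¹' ((· + q) ⁻¹' A)) :=
          measure_mono fun x hx => by
            have := hx.2
            rwa [mem_preimage, hmq x hx.1] at this
      _ = ENNReal.ofReal σ⁻¹ * volume A := by
        rw [Real.volume_preimage_mul_left hm0, measure_preimage_add_right, abs_inv, hm]
  · calc volume (Icc a c ∩ g ⁻¹' A) ≤ volume (Icc a c) := measure_mono inter_subset_left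
      _ = 0 := by rw [Real.volume_Icc, ENNReal.ofReal_eq_zero]; linarith
      _ ≤ _ := zero_le

lemma AffineOff.volume_preimage_near_le {g : ℝ → ℝ} {σ : ℝ} (hσ : 0 < σ) {P : Set ℝ}
    (hg : AffineOff g σ P) {δ : ℝ} (hδ : ∀ x ∈ P, ∀ y ∈ P, x ≠ y → 2 * δ ≤ |x - y|)
    (z : ℝ) (A : Set ℝ) :
    volume {y ∈ Icc (-1 : ℝ) 1 | |y - z| < δ ∧ g y ∈ A} ≤ ENNReal.ofReal (2 / σ) * volume A := by
  obtain ⟨p, hleft, hright⟩ : ∃ p, (∀ r ∈ P, r ∉ Ioo (max (-1) (z - δ)) (min 1 p)) ∧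
      ∀ r ∈ P, r ∉ Ioo (max (-1) p) (min 1 (z + δ)) := by
    by_cases h : ∃ p ∈ P, p ∈ Ioo (z - δ) (z + δ)
    · obtain ⟨p, hp, hpz⟩ := h
      refine ⟨p, fun r hr hmem => ?_, fun r hr hmem => ?_⟩
      · have h1 := (max_lt_iff.1 hmem.1).2
        have h2 := (lt_min_iff.1 hmem.2).2
        have := hδ p hp r hr h2.ne'
        rw [abs_of_pos (by linarith)] at this
        linarith [hpz.2]
      · have h1 := (max_lt_iff.1 hmem.1).2
        have h2 := (lt_min_iff.1 hmem.2).2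
        have := hδ r hr p hp h1.ne'
        rw [abs_of_pos (by linarith)] at this
        linarith [hpz.1]
    · refine ⟨z + δ, fun r hr hmem => h ⟨r, hr, (max_lt_iff.1 hmem.1).2, (lt_min_iff.1 hmem.2).2⟩,
        fun r _ hmem => ?_⟩
      linarith [(max_lt_iff.1 hmem.1).2, (lt_min_iff.1 hmem.2).2]
  calc volume {y ∈ Icc (-1 : ℝ) 1 | |y - z| < δ ∧ g y ∈ A}
      ≤ volume ((Icc (max (-1) (z - δ)) (min 1 p) ∩ g ⁻¹' A) ∪
          (Icc (max (-1) p) (min 1 (z + δ)) ∩ g ⁻¹' A)) := by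
        refine measure_mono fun y hy => ?_
        obtain ⟨hyI, hyz, hyA⟩ := hy
        rw [abs_lt] at hyz
        rcases le_total y p with hyp | hyp
        · exact Or.inl ⟨⟨max_le hyI.1 (by linarith), le_min hyI.2 hyp⟩, hyA⟩
        · exact Or.inr ⟨⟨max_le hyI.1 hyp, le_min hyI.2 (by linarith)⟩, hyA⟩
    _ ≤ ENNReal.ofReal σ⁻¹ * volume A + ENNReal.ofReal σ⁻¹ * volume A :=
        (measure_union_le _ _).trans (add_le_add
          (hg.volume_preimage_Icc_le hσ (le_max_left _ _) (min_le_left _ _) hleft A)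
          (hg.volume_preimage_Icc_le hσ (le_max_left _ _) (min_le_left _ _) hright A))
    _ = ENNReal.ofReal (2 / σ) * volume A := by
        rw [← add_mul, ← ENNReal.ofReal_add (by positivity) (by positivity)]
        congr 2
        ring

/-- The set of points whose `g`-orbit follows a prescribed sequence up to `δ` for `n` steps has
measure at most `2 (2 / σ) ^ n`. -/
lemma AffineOff.volume_shadowing_le {g : ℝ → ℝ} {σ : ℝ} (hσ : 0 < σ) {P : Set ℝ}
    (hg : AffineOff g σ P) (hmaps : MapsTo g (Icc (-1) 1) (Icc (-1) 1)) {δ : ℝ}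
    (hδ : ∀ x ∈ P, ∀ y ∈ P, x ≠ y → 2 * δ ≤ |x - y|) (n : ℕ) :
    ∀ ξ : ℕ → ℝ, volume {y ∈ Icc (-1 : ℝ) 1 | ∀ k < n, |g^[k] y - ξ k| < δ} ≤
      ENNReal.ofReal ((2 / σ) ^ n * 2) := by
  induction n with
  | zero =>
    intro ξ
    refine (measure_mono (sep_subset _ _)).trans ?_
    rw [Real.volume_Icc]
    apply ENNReal.ofReal_le_ofReal
    norm_num
  | succ n ih =>
    intro ξ
    calc volume {y ∈ Icc (-1 : ℝ) 1 | ∀ k < n + 1, |g^[k] y - ξ k| < δ}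
        ≤ volume {y ∈ Icc (-1 : ℝ) 1 | |y - ξ 0| < δ ∧
            g y ∈ {y ∈ Icc (-1 : ℝ) 1 | ∀ k < n, |g^[k] y - ξ (k + 1)| < δ}} :=
          measure_mono fun y hy => ⟨hy.1, hy.2 0 n.succ_pos, hmaps hy.1,
            fun k hk => hy.2 (k + 1) (Nat.succ_lt_succ hk)⟩
      _ ≤ ENNReal.ofReal (2 / σ) *
            volume {y ∈ Icc (-1 : ℝ) 1 | ∀ k < n, |g^[k] y - ξ (k + 1)| < δ} :=
          hg.volume_preimage_near_le hσ hδ _ _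
      _ ≤ ENNReal.ofReal (2 / σ) * ENNReal.ofReal ((2 / σ) ^ n * 2) := by
          gcongr
          exact ih fun k => ξ (k + 1)
      _ = ENNReal.ofReal ((2 / σ) ^ (n + 1) * 2) := by
          rw [← ENNReal.ofReal_mul (by positivity)]
          congr 1
          ring

lemma pow_le_card_of_isDynCoverOf {f : ℝ → ℝ} {σ : ℝ} (hσ : 0 < σ) {N : ℕ} (hN : 0 < N)
    {P : Set ℝ} (hg : AffineOff f^[N] σ P) (hmaps : MapsTo f (Icc (-1) 1) (Icc (-1) 1)) {δ : ℝ}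
    (hδ : ∀ x ∈ P, ∀ y ∈ P, x ≠ y → 2 * δ ≤ |x - y|) {n : ℕ} {t : Finset ℝ}
    (ht : IsDynCoverOf f (Icc (-1) 1) {p : ℝ × ℝ | dist p.1 p.2 < δ} (N * n) (t : Set ℝ)) :
    (σ / 2) ^ n ≤ t.card := by
  have hcover : Icc (-1 : ℝ) 1 ⊆
      ⋃ x ∈ t, {y ∈ Icc (-1 : ℝ) 1 | ∀ k < n, |(f^[N])^[k] y - (f^[N])^[k] x| < δ} := by
    intro y hy
    obtain ⟨x, hx, hyx⟩ := ht hy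
    refine mem_biUnion hx ⟨hy, fun k hk => ?_⟩
    have h := mem_dynEntourage.1 hyx (N * k) (Nat.mul_lt_mul_of_pos_left hk hN)
    rw [mem_ofPred_eq, Real.dist_eq] at h
    rwa [← Function.iterate_mul]
  have hvol : ENNReal.ofReal 2 ≤ ENNReal.ofReal (t.card * ((2 / σ) ^ n * 2)) := by
    calc ENNReal.ofReal 2 = volume (Icc (-1 : ℝ) 1) := by rw [Real.volume_Icc]; norm_num
      _ ≤ ∑ x ∈ t, volume
            {y ∈ Icc (-1 : ℝ) 1 | ∀ k < n, |(f^[N])^[k] y - (f^[N])^[k] x| < δ} :=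
          (measure_mono hcover).trans (measure_biUnion_finset_le _ _)
      _ ≤ ∑ _x ∈ t, ENNReal.ofReal ((2 / σ) ^ n * 2) :=
          Finset.sum_le_sum fun x _ =>
            hg.volume_shadowing_le hσ (hmaps.iterate N) hδ n fun k => (f^[N])^[k] x
      _ = ENNReal.ofReal (t.card * ((2 / σ) ^ n * 2)) := by
          rw [Finset.sum_const, nsmul_eq_mul, ENNReal.ofReal_mul t.card.cast_nonneg,
            ENNReal.ofReal_natCast]
  rw [ENNReal.ofReal_le_ofReal_iff (by positivity)] at hvol
  have hprod : (σ / 2) ^ n * (2 / σ) ^ n = 1 := by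
    rw [← mul_pow, div_mul_div_cancel₀ two_ne_zero, div_self hσ.ne', one_pow]
  calc (σ / 2) ^ n = (σ / 2) ^ n * 1 := by ring
    _ ≤ (σ / 2) ^ n * (t.card * (2 / σ) ^ n) := by gcongr; linarith
    _ = t.card * ((σ / 2) ^ n * (2 / σ) ^ n) := by ring
    _ = t.card := by rw [hprod, mul_one]

lemma log_sub_le_coverEntropy {f : ℝ → ℝ} {s : ℝ} (hs : 0 < s) {N : ℕ} (hN : 0 < N)
    {P : Set ℝ} (hP : P.Finite) (hg : AffineOff f^[N] (s ^ N) P)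
    (hmaps : MapsTo f (Icc (-1) 1) (Icc (-1) 1)) :
    ((Real.log s - Real.log 2 / N : ℝ) : EReal) ≤ coverEntropy f (Icc (-1) 1) := by
  obtain ⟨δ, hδ, hsep⟩ := hP.exists_pos_forall_le_abs_sub
  have hN' : (N : ℝ) ≠ 0 := by positivity
  refine le_trans ?_ (coverEntropyEntourage_le_coverEntropy f (Icc (-1) 1)
    (Metric.dist_mem_uniformity (half_pos hδ)))
  refine Frequently.le_expGrowthSup (frequently_atTop.2 fun n => ⟨N * n, ?_, ?_⟩)
  · exact Nat.le_mul_of_pos_left n hN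
  · have hexp : Real.exp ((Real.log s - Real.log 2 / N) * (N * n : ℕ)) = (s ^ N / 2) ^ n := by
      rw [← Real.exp_log (show 0 < (s ^ N / 2) ^ n by positivity), Real.log_pow,
        Real.log_div (by positivity) two_ne_zero, Real.log_pow]
      congr 1
      push_cast
      field_simp
    rw [show (((N * n : ℕ) : EReal)) = (((N * n : ℕ) : ℝ) : EReal) from rfl, ← EReal.coe_mul,
      EReal.exp_coe, hexp]
    by_cases hinf : coverMincard f (Icc (-1) 1) {p : ℝ × ℝ | dist p.1 p.2 < δ / 2} (N * n) = ⊤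
    · rw [hinf]; simp
    · obtain ⟨t, ht, hcard⟩ := (coverMincard_finite_iff _ _ _ _).1 (lt_top_iff_ne_top.2 hinf)
      rw [← hcard, ENat.toENNReal_coe, ← ENNReal.ofReal_natCast]
      apply ENNReal.ofReal_le_ofReal
      refine pow_le_card_of_isDynCoverOf (by positivity) hN hg hmaps ?_ ht
      simpa only [mul_div_cancel₀ δ (two_ne_zero' ℝ)] using hsep

lemma AffineOff.log_le_coverEntropy {f : ℝ → ℝ} {s : ℝ} (hs : 0 < s) {P : Set ℝ}
    (hP : P.Finite) (hf : AffineOff f s P) (hmaps : MapsTo f (Icc (-1) 1) (Icc (-1) 1))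
    (hfib : ∀ y, {x ∈ Icc (-1 : ℝ) 1 | f x = y}.Finite) :
    (Real.log s : EReal) ≤ coverEntropy f (Icc (-1) 1) := by
  have hlim : Tendsto (fun N : ℕ => ((Real.log s - Real.log 2 / N : ℝ) : EReal)) atTop
      (nhds ((Real.log s - 0 : ℝ) : EReal)) :=
    (continuous_coe_real_ereal.tendsto _).comp
      (tendsto_const_nhds.sub (tendsto_const_div_atTop_nhds_zero_nat _))
  rw [sub_zero] at hlim
  refine le_of_tendsto hlim ((eventually_gt_atTop 0).mono fun N hN => ?_)
  obtain ⟨Q, hQ, hfN⟩ := hf.iterate hs hP hmaps hfib N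
  exact log_sub_le_coverEntropy hs hN hQ hfN hmaps

/-! ### Tent maps -/

lemma cpt_zero (b : ℕ) : cpt b 0 = -1 := by simp [cpt]

lemma cpt_last (b : ℕ) : cpt b (b + 1) = 1 := by
  have : (b : ℝ) + 1 ≠ 0 := by positivity
  simp only [cpt]
  push_cast
  field_simp
  ring

lemma cpt_strictMono (b : ℕ) : StrictMono (cpt b) := by
  intro i j hij
  have : (i : ℝ) < j := by exact_mod_cast hij
  unfold cpt
  gcongr

lemma exists_mem_Ico_cpt (b : ℕ) {x : ℝ} (hx : x ∈ Ico (-1 : ℝ) 1) :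
    ∃ i ≤ b, x ∈ Ico (cpt b i) (cpt b (i + 1)) := by
  classical
  have hex : ∃ j, x < cpt b j := ⟨b + 1, by rw [cpt_last]; exact hx.2⟩
  obtain ⟨i, hi⟩ : ∃ i, Nat.find hex = i + 1 := Nat.exists_eq_succ_of_ne_zero fun h => by
    have := Nat.find_spec hex
    rw [h, cpt_zero] at this
    linarith [hx.1]
  refine ⟨i, ?_, ?_, hi ▸ Nat.find_spec hex⟩
  · have := Nat.find_min' hex (m := b + 1) (by rw [cpt_last]; exact hx.2)
    omega
  · exact not_lt.1 (Nat.find_min hex (m := i) (by omega))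

lemma exists_mem_Icc_cpt (b : ℕ) {x : ℝ} (hx : x ∈ Icc (-1 : ℝ) 1) :
    ∃ i ≤ b, x ∈ Icc (cpt b i) (cpt b (i + 1)) := by
  rcases hx.2.lt_or_eq with h | rfl
  · obtain ⟨i, hi, hxi⟩ := exists_mem_Ico_cpt b ⟨hx.1, h⟩
    exact ⟨i, hi, Ico_subset_Icc_self hxi⟩
  · refine ⟨b, le_rfl, ?_, (cpt_last b).ge⟩
    rw [← cpt_last b]
    exact (cpt_strictMono b).monotone (Nat.le_succ b)

section Tent

variable {b : ℕ} {ε s : ℝ} {v : Fin b → ℝ} {f : ℝ → ℝ}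

lemma vext_mem_Icc (hε : ε = -1 ∨ ε = 1) (hv : Admissible b ε v) (i : ℕ) :
    vext b ε v i ∈ Icc (-1 : ℝ) 1 := by
  unfold vext
  split_ifs with h1 h2
  · exact hv.1 _
  · rcases hε with rfl | rfl <;> simp
  · rcases neg_one_pow_eq_or ℝ (b + 1) with h | h <;> rw [h] <;> rcases hε with rfl | rfl <;> simp

lemma IsTentMap.mapsTo (hε : ε = -1 ∨ ε = 1) (hf : IsTentMap b ε v f) :
    MapsTo f (Icc (-1) 1) (Icc (-1) 1) := by
  intro x hx
  obtain ⟨i, hi, hxi⟩ := exists_mem_Icc_cpt b hx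
  obtain ⟨m, q, hmq⟩ := hf.2.2 i hi
  have hlt := cpt_strictMono b (Nat.lt_succ_self i)
  have h1 := vext_mem_Icc hε hf.1 i
  have h2 := vext_mem_Icc hε hf.1 (i + 1)
  rw [← hf.2.1 i (by omega), hmq _ ⟨le_rfl, hlt.le⟩] at h1
  rw [← hf.2.1 (i + 1) (by omega), hmq _ ⟨hlt.le, le_rfl⟩] at h2
  rw [hmq x hxi]
  rcases le_total 0 m with hm | hm
  · have := mul_le_mul_of_nonneg_left hxi.1 hm
    have := mul_le_mul_of_nonneg_left hxi.2 hm
    constructor <;> linarith [h1.1, h2.2]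
  · have := mul_le_mul_of_nonpos_left hxi.1 hm
    have := mul_le_mul_of_nonpos_left hxi.2 hm
    constructor <;> linarith [h1.2, h2.1]

lemma IsTentMap.exists_slope (hf : IsTentMap b ε v f)
    (hslope : ∀ x ∈ Ioo (-1 : ℝ) 1, DifferentiableAt ℝ f x → |deriv f x| = s) {i : ℕ}
    (hi : i ≤ b) :
    ∃ m q : ℝ, |m| = s ∧ ∀ x ∈ Icc (cpt b i) (cpt b (i + 1)), f x = m * x + q := by
  obtain ⟨m, q, hmq⟩ := hf.2.2 i hi
  refine ⟨m, q, ?_, hmq⟩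
  obtain ⟨x, hx⟩ := exists_between (cpt_strictMono b (Nat.lt_succ_self i))
  have hd : HasDerivAt f m x := by
    have haff : HasDerivAt (fun y => m * y + q) m x := by
      simpa using ((hasDerivAt_id x).const_mul m).add_const q
    exact haff.congr_of_eventuallyEq
      (eventually_of_mem (Icc_mem_nhds hx.1 hx.2) fun y hy => hmq y hy)
  rw [← hd.deriv]
  refine hslope x ⟨?_, ?_⟩ hd.differentiableAt
  · rw [← cpt_zero b]
    exact ((cpt_strictMono b).monotone i.zero_le).trans_lt hx.1
  · rw [← cpt_last b]
    exact hx.2.trans_le ((cpt_strictMono b).monotone (by omega))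

lemma IsTentMap.affineOff (hf : IsTentMap b ε v f)
    (hslope : ∀ x ∈ Ioo (-1 : ℝ) 1, DifferentiableAt ℝ f x → |deriv f x| = s) :
    AffineOff f s (cpt b '' Iic (b + 1)) := by
  intro a c ha hac hc hmiss
  obtain ⟨i, hi, hlo, hhi⟩ := exists_mem_Ico_cpt b (x := (a + c) / 2)
    ⟨by linarith, by linarith⟩
  obtain ⟨m, q, hm, hmq⟩ := hf.exists_slope hslope hi
  refine ⟨m, q, hm, fun x hx => hmq x ⟨?_, ?_⟩⟩
  · by_contra h
    exact hmiss _ (mem_image_of_mem (cpt b) (mem_Iic.2 (show i ≤ b + 1 by omega)))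
      ⟨by linarith [hx.1], by linarith⟩
  · by_contra h
    exact hmiss _ (mem_image_of_mem (cpt b) (mem_Iic.2 (show i + 1 ≤ b + 1 by omega)))
      ⟨by linarith, by linarith [hx.2]⟩

lemma IsTentMap.finite_fiber (hs : 0 < s) (hf : IsTentMap b ε v f)
    (hslope : ∀ x ∈ Ioo (-1 : ℝ) 1, DifferentiableAt ℝ f x → |deriv f x| = s) (y : ℝ) :
    {x ∈ Icc (-1 : ℝ) 1 | f x = y}.Finite := by
  refine ((finite_Iic b).biUnion (t := fun i => Icc (cpt b i) (cpt b (i + 1)) ∩ {x | f x = y})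
    fun i hi => Set.Subsingleton.finite fun x hx x' hx' => ?_).subset fun x hx => ?_
  · obtain ⟨m, q, hm, hmq⟩ := hf.exists_slope hslope hi
    have hm0 : m ≠ 0 := by rintro rfl; simp at hm; linarith
    have h : m * x + q = m * x' + q := by
      rw [← hmq x hx.1, ← hmq x' hx'.1]
      exact hx.2.trans hx'.2.symm
    exact mul_left_cancel₀ hm0 (add_right_cancel h)
  · obtain ⟨i, hi, hxi⟩ := exists_mem_Icc_cpt b hx.1
    exact mem_biUnion (mem_Iic.2 hi) ⟨hxi, hx.2⟩

lemma IsTentMap.abs_sub_le (hf : IsTentMap b ε v f)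
    (hslope : ∀ x ∈ Ioo (-1 : ℝ) 1, DifferentiableAt ℝ f x → |deriv f x| = s) :
    ∀ x ∈ Icc (-1 : ℝ) 1, ∀ y ∈ Icc (-1 : ℝ) 1, |f x - f y| ≤ s * |x - y| := by
  have key : ∀ k ≤ b + 1, ∀ x y, -1 ≤ x → x ≤ y → y ≤ cpt b k → |f x - f y| ≤ s * (y - x) := by
    intro k
    induction k with
    | zero =>
      intro _ x y hx hxy hy
      rw [cpt_zero] at hy
      obtain rfl : x = y := by linarith
      simp
    | succ k ih =>
      intro hk x y hx hxy hy
      have ih := ih (by omega)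
      obtain ⟨m, q, hm, hmq⟩ := hf.exists_slope hslope (show k ≤ b by omega)
      have hpiece : ∀ x y, cpt b k ≤ x → x ≤ y → y ≤ cpt b (k + 1) →
          |f x - f y| ≤ s * (y - x) := by
        intro x y hx hxy hy
        rw [hmq x ⟨hx, hxy.trans hy⟩, hmq y ⟨hx.trans hxy, hy⟩,
          show m * x + q - (m * y + q) = m * (x - y) by ring, abs_mul, hm, abs_sub_comm,
          abs_of_nonneg (by linarith)]
      rcases le_total y (cpt b k) with hyk | hyk
      · exact ih x y hx hxy hyk
      rcases le_total (cpt b k) x with hxk | hxk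
      · exact hpiece x y hxk hxy hy
      calc |f x - f y| ≤ |f x - f (cpt b k)| + |f (cpt b k) - f y| := _root_.abs_sub_le _ _ _
        _ ≤ s * (cpt b k - x) + s * (y - cpt b k) :=
          add_le_add (ih _ _ hx hxk le_rfl) (hpiece _ _ le_rfl hyk hy)
        _ = s * (y - x) := by ring
  have key := key (b + 1) le_rfl
  rw [cpt_last] at key
  intro x hx y hy
  rcases le_total x y with h | h
  · rw [abs_sub_comm x y, abs_of_nonneg (sub_nonneg.2 h)]
    exact key x y hx.1 h hy.2
  · rw [abs_sub_comm (f x), abs_of_nonneg (sub_nonneg.2 h)]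
    exact key y x hy.1 h hx.2

end Tent

/-- If `f ∈ T^b_ε` has constant slope `±s` for some `s > 0`, i.e. `|f′(x)| = s` at
every point where `f` is differentiable, then `h_top(f) = max(log s, 0)`. -/
theorem tent_map_constant_slope_entropy (b : ℕ) (hb : 1 ≤ b) (ε : ℝ)
    (hε : ε = -1 ∨ ε = 1) (v : Fin b → ℝ) (f : ℝ → ℝ) (hf : IsTentMap b ε v f)
    (s : ℝ) (hs : 0 < s)
    (hslope : ∀ x ∈ Set.Ioo (-1 : ℝ) 1, DifferentiableAt ℝ f x → |deriv f x| = s) :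
    htop f = ((max (Real.log s) 0 : ℝ) : EReal) := by
  have hmaps := hf.mapsTo hε
  refine le_antisymm ?_ ?_
  · have hlog : Real.log (max s 1) = max (Real.log s) 0 := by
      rcases le_total s 1 with h | h
      · rw [max_eq_right h, Real.log_one, max_eq_right (Real.log_nonpos hs.le h)]
      · rw [max_eq_left h, max_eq_left (Real.log_nonneg h)]
    rw [← hlog]
    refine coverEntropy_le_log_of_lipschitz (le_max_right _ _) hmaps fun x hx y hy =>
      (hf.abs_sub_le hslope x hx y hy).trans ?_
    gcongr
    exact le_max_left _ _
  · rw [EReal.coe_strictMono.monotone.map_max]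
    exact max_le ((hf.affineOff hslope).log_le_coverEntropy hs ((finite_Iic _).image _) hmaps
      (hf.finite_fiber hs hslope)) (coverEntropy_nonneg f ⟨0, by norm_num⟩)
end

section
/- The set { log s : s ∈ (1, 2] and there exists an integer R ≥ 1 with T_s^R(0) = 0 }, where T_s : [−1,1] → [−1,1] is the tent map T_s(x) = s − 1 − s·|x|, is dense in the interval [0, log 2]. -/
/-- The tent map `T_s(x) = s - 1 - s·|x|` of slope `±s`. -/
noncomputable def tentSlope (s : ℝ) (x : ℝ) : ℝ := s - 1 - s * |x|

open Set Filter Topology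

theorem continuous_tentSlope_iterate (n : ℕ) : Continuous fun s : ℝ => (tentSlope s)^[n] 0 := by
  induction n with
  | zero => simpa using continuous_const
  | succ n ih =>
    simp only [Function.iterate_succ_apply', tentSlope] at ih ⊢
    fun_prop

theorem abs_tentSlope_le_one {s x : ℝ} (hs : s ∈ Ioo (1 : ℝ) 2) (hx : |x| ≤ 1) :
    |tentSlope s x| ≤ 1 := by
  obtain ⟨h1, h2⟩ := hs
  have := abs_nonneg x
  rw [tentSlope, abs_le]
  constructor <;> nlinarith

theorem abs_tentSlope_iterate_le_one {s : ℝ} (hs : s ∈ Ioo (1 : ℝ) 2) (n : ℕ) :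
    |(tentSlope s)^[n] 0| ≤ 1 := by
  induction n with
  | zero => simp
  | succ n ih =>
    rw [Function.iterate_succ_apply']
    exact abs_tentSlope_le_one hs ih

/-- A continuous function without zeros on an interval has constant sign there. -/
theorem exists_sign_of_ne_zero {f : ℝ → ℝ} (hf : Continuous f) {a b : ℝ}
    (h : ∀ s ∈ Ioo a b, f s ≠ 0) :
    ∃ σ : ℝ, σ * σ = 1 ∧ ∀ s ∈ Ioo a b, |f s| = -σ * f s := by
  by_cases hpos : ∃ s ∈ Ioo a b, 0 < f s
  · obtain ⟨u, hu, hfu⟩ := hpos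
    refine ⟨-1, by norm_num, fun s hs => ?_⟩
    rcases lt_or_ge (f s) 0 with hlt | hge
    · obtain ⟨v, hv, hv0⟩ := isPreconnected_Ioo.intermediate_value hs hu hf.continuousOn
        ⟨hlt.le, hfu.le⟩
      exact absurd hv0 (h v hv)
    · rw [abs_of_nonneg hge]; ring
  · push Not at hpos
    refine ⟨1, by norm_num, fun s hs => ?_⟩
    rw [abs_of_nonpos (hpos s hs)]; ring

/-- A real power series with coefficients bounded by `1` and nonzero constant term does not vanish
identically on a nonempty open subinterval of the unit ball. -/
theorem exists_not_hasSum_zero {c : ℕ → ℝ} (hc : ∀ n, |c n| ≤ 1) (hc0 : c 0 ≠ 0)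
    {U : Set ℝ} (hU : IsOpen U) (hne : U.Nonempty) (hU1 : U ⊆ Metric.ball 0 1) :
    ∃ t ∈ U, ¬ HasSum (fun n => c n * t ^ n) 0 := by
  by_contra! hsum
  set p := FormalMultilinearSeries.ofScalars ℝ c with hp
  have hrad : (1 : ENNReal) ≤ p.radius := by
    refine p.le_radius_of_bound (r := 1) 1 fun n => ?_
    simpa [hp, FormalMultilinearSeries.ofScalars_norm] using hc n
  have hball : HasFPowerSeriesOnBall p.sum p 0 p.radius :=
    p.hasFPowerSeriesOnBall (zero_lt_one.trans_le hrad)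
  have hsub : Metric.ball (0 : ℝ) 1 ⊆ Metric.eball 0 p.radius := by
    intro x hx
    refine Metric.eball_subset_eball hrad ?_
    simpa [← Metric.eball_ofReal] using hx
  have han : AnalyticOnNhd ℝ p.sum (Metric.ball 0 1) := hball.analyticOnNhd.mono hsub
  have hzero : ∀ t ∈ U, p.sum t = 0 := by
    intro t ht
    have := hball.hasSum_sub (hsub (hU1 ht))
    refine this.unique ?_
    simpa [hp, FormalMultilinearSeries.ofScalars_apply_eq, mul_comm] using hsum t ht
  obtain ⟨t, ht⟩ := hne
  have heq := han.eqOn_zero_of_preconnected_of_eventuallyEq_zero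
    (convex_ball (0 : ℝ) 1).isPreconnected (hU1 ht)
    (by filter_upwards [hU.mem_nhds ht] with x hx using hzero x hx)
  have hev : p.sum =ᶠ[𝓝 0] 0 := by
    filter_upwards [Metric.ball_mem_nhds (0 : ℝ) one_pos] with x hx using heq hx
  have hp0 : p = 0 := hball.hasFPowerSeriesAt.eq_zero_of_eventually hev
  rw [hp, FormalMultilinearSeries.ofScalars_series_eq_zero] at hp0
  exact hc0 (congrFun hp0 0)

/-- Parameters with periodic turning point exist in every nondegenerate interval inside `(1, 2)`. -/
theorem exists_tentSlope_iterate_eq_zero {a b : ℝ} (hab : a < b) (ha : 1 ≤ a) (hb : b ≤ 2) :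
    ∃ s ∈ Ioo a b, ∃ R : ℕ, 1 ≤ R ∧ (tentSlope s)^[R] 0 = 0 := by
  by_contra! hno
  have hsub : ∀ s ∈ Ioo a b, s ∈ Ioo (1 : ℝ) 2 := fun s hs =>
    ⟨ha.trans_lt hs.1, hs.2.trans_le hb⟩
  choose σ hσ hsign using fun n : ℕ => exists_sign_of_ne_zero
    (continuous_tentSlope_iterate (n + 1)) (fun s hs => hno s hs (n + 1) (by omega))
  let c : ℕ → ℝ := fun n => ∏ k ∈ Finset.range n, σ k
  have hc : ∀ n, |c n| = 1 := fun n => by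
    rw [Finset.abs_prod]
    refine Finset.prod_eq_one fun k _ => ?_
    rcases mul_self_eq_one_iff.mp (hσ k) with h | h <;> simp [h]
  have key : ∀ s ∈ Ioo a b, ∀ n, (s - 1) * ∑ k ∈ Finset.range (n + 1), c k * s⁻¹ ^ k =
      (tentSlope s)^[n + 1] 0 * c n * s⁻¹ ^ n := by
    intro s hs n
    have hs0 : s ≠ 0 := by linarith [(hsub s hs).1]
    induction n with
    | zero => simp [c, tentSlope]
    | succ n ih =>
      have hstep : (tentSlope s)^[n + 1 + 1] 0 = s - 1 + s * σ n * (tentSlope s)^[n + 1] 0 := by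
        rw [Function.iterate_succ_apply', tentSlope, hsign n s hs]; ring
      have hcs : c (n + 1) = c n * σ n := Finset.prod_range_succ _ _
      rw [Finset.sum_range_succ, mul_add, ih, hstep, hcs, pow_succ]
      have hinv : s * s⁻¹ = 1 := mul_inv_cancel₀ hs0
      linear_combination (-(tentSlope s)^[n + 1] 0 * c n * s⁻¹ ^ n) * hσ n
        - (tentSlope s)^[n + 1] 0 * c n * s⁻¹ ^ n * (σ n * σ n) * hinv
  have ha0 : 0 < a := one_pos.trans_le ha
  obtain ⟨t, ht, hnot⟩ := exists_not_hasSum_zero (c := c) (fun n => (hc n).le) (by simp [c])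
    (isOpen_Ioo (a := b⁻¹) (b := a⁻¹)) (nonempty_Ioo.2 (inv_strictAnti₀ ha0 hab)) (by
      intro t ht
      have h0 : 0 < t := (inv_pos.2 (ha0.trans hab)).trans ht.1
      simpa [abs_of_pos h0] using ht.2.trans_le (inv_le_one_of_one_le₀ ha))
  have ht0 : 0 < t := (inv_pos.2 (ha0.trans hab)).trans ht.1
  have hs : t⁻¹ ∈ Ioo a b :=
    ⟨(lt_inv_comm₀ ht0 ha0).1 ht.2, (inv_lt_comm₀ (ha0.trans hab) ht0).1 ht.1⟩
  have hs1 : 0 < t⁻¹ - 1 := sub_pos.2 (hsub _ hs).1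
  have ht1 : t < 1 := ht.2.trans_le (inv_le_one_of_one_le₀ ha)
  have hsummable : Summable fun n => c n * t ^ n := by
    refine Summable.of_norm_bounded (summable_geometric_of_lt_one ht0.le ht1) fun n => ?_
    simp [hc, abs_of_pos ht0]
  refine hnot (hsummable.hasSum_iff_tendsto_nat.2 ((tendsto_add_atTop_iff_nat 1).1 ?_))
  have hlim : Tendsto (fun n => (t⁻¹ - 1)⁻¹ * t ^ n) atTop (𝓝 0) := by
    simpa using (tendsto_pow_atTop_nhds_zero_of_lt_one ht0.le ht1).const_mul (t⁻¹ - 1)⁻¹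
  refine squeeze_zero_norm (fun n => ?_) hlim
  have hk := key _ hs n
  rw [inv_inv] at hk
  rw [le_inv_mul_iff₀ hs1, Real.norm_eq_abs, ← abs_of_pos hs1, ← abs_mul, hk,
    abs_mul, abs_mul, hc, mul_one, abs_of_pos (pow_pos ht0 n)]
  exact mul_le_of_le_one_left (pow_pos ht0 n).le (abs_tentSlope_iterate_le_one (hsub _ hs) _)

/-- The set `{log s : s ∈ (1,2], T_s^R(0) = 0 for some integer R ≥ 1}` is dense in
the interval `[0, log 2]`. -/
theorem tent_periodic_turning_entropies_dense :
    ∀ y ∈ Set.Icc (0 : ℝ) (Real.log 2),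
      y ∈ closure {x : ℝ | ∃ s : ℝ, s ∈ Set.Ioc (1 : ℝ) 2 ∧
        (∃ R : ℕ, 1 ≤ R ∧ (tentSlope s)^[R] 0 = 0) ∧ x = Real.log s} := by
  intro y hy
  set S : Set ℝ := {s | s ∈ Ioc (1 : ℝ) 2 ∧ ∃ R : ℕ, 1 ≤ R ∧ (tentSlope s)^[R] 0 = 0}
  have hdense : Ioo (1 : ℝ) 2 ⊆ closure S := by
    intro s hs
    refine mem_closure_iff_nhds.2 fun V hV => ?_
    obtain ⟨a, b, hsab, hab⟩ := mem_nhds_iff_exists_Ioo_subset.1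
      (inter_mem hV (isOpen_Ioo.mem_nhds hs))
    obtain ⟨l, hl, hlb⟩ := exists_between hsab.2
    have hs' := hab hsab
    have hl' := hab ⟨hsab.1.trans hl, hlb⟩
    obtain ⟨u, hu, hR⟩ := exists_tentSlope_iterate_eq_zero hl hs'.2.1.le hl'.2.2.le
    have hu' := hab ⟨hsab.1.trans hu.1, hu.2.trans hlb⟩
    exact ⟨u, hu'.1, ⟨hu'.2.1, hu'.2.2.le⟩, hR⟩
  have hexp : Real.exp y ∈ closure S := by
    refine closure_minimal hdense isClosed_closure ?_
    rw [closure_Ioo (by norm_num)]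
    exact ⟨Real.one_le_exp hy.1, (Real.le_log_iff_exp_le two_pos).1 hy.2⟩
  have hlog := mem_closure_image
    (Real.continuousAt_log (Real.exp_pos y).ne') hexp
  rw [Real.log_exp] at hlog
  refine closure_mono ?_ hlog
  rintro _ ⟨s, ⟨hs, hR⟩, rfl⟩
  exact ⟨s, hs, hR, rfl⟩
end

section
/- Let f : [−1,1] → [−1,1] be a continuous piecewise monotone map, and for each n ≥ 1 let ℓ(f^n) denote the lap number of the n-th iterate f^n, i.e., the number of maximal intervals on which f^n is monotone. Then the limit lim_{n→∞} (1/n)·log ℓ(f^n) exists and equals the topological entropy h_top(f). -/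
/-- `f` is piecewise monotone on `[-1,1]`: the interval is a finite union of
subintervals on each of which `f` is monotone. -/
def PiecewiseMonotone (f : ℝ → ℝ) : Prop :=
  ∃ n : ℕ, ∃ a : Fin (n + 1) → ℝ, StrictMono a ∧ a 0 = -1 ∧ a (Fin.last n) = 1 ∧
    ∀ i : Fin n, MonotoneOn f (Set.Icc (a i.castSucc) (a i.succ)) ∨
      AntitoneOn f (Set.Icc (a i.castSucc) (a i.succ))

/-- `J` is a lap of `f`: a maximal (nondegenerate) subinterval of `[-1,1]` on which
`f` is monotone. -/
def IsLap (f : ℝ → ℝ) (J : Set ℝ) : Prop :=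
  J ⊆ Set.Icc (-1) 1 ∧ J.OrdConnected ∧ J.Nontrivial ∧
  (MonotoneOn f J ∨ AntitoneOn f J) ∧
  ∀ J' : Set ℝ, J' ⊆ Set.Icc (-1) 1 → J'.OrdConnected →
    (MonotoneOn f J' ∨ AntitoneOn f J') → J ⊆ J' → J' = J

/-- The lap number `ℓ(f)`: the number of laps of `f`. -/
noncomputable def lapNum (f : ℝ → ℝ) : ℕ := Nat.card {J : Set ℝ // IsLap f J}

open Set Filter Topology

/-- A subinterval of `[-1,1]`, possibly degenerate or empty, on which `g` is monotone or
antitone. -/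
structure IsMonoPiece (g : ℝ → ℝ) (A : Set ℝ) : Prop where
  subset : A ⊆ Icc (-1) 1
  ordConnected : A.OrdConnected
  mono : MonotoneOn g A ∨ AntitoneOn g A

/-- A family of monotone pieces of `g` covering `[-1,1]`. -/
structure IsMonoCover {ι : Type*} (g : ℝ → ℝ) (J : ι → Set ℝ) : Prop where
  piece : ∀ i, IsMonoPiece g (J i)
  cover : ∀ x ∈ Icc (-1 : ℝ) 1, ∃ i, x ∈ J i

theorem Set.OrdConnected.union_of_mem {A B : Set ℝ} (hA : A.OrdConnected) (hB : B.OrdConnected)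
    {x : ℝ} (hxA : x ∈ A) (hxB : x ∈ B) : (A ∪ B).OrdConnected := by
  rw [← isPreconnected_iff_ordConnected] at *
  exact hA.union x hxA hxB hB

theorem MonotoneOn.union_of_mem {g : ℝ → ℝ} {A B : Set ℝ} (hA : A.OrdConnected)
    (hB : B.OrdConnected) {x : ℝ} (hxA : x ∈ A) (hxB : x ∈ B) (hgA : MonotoneOn g A)
    (hgB : MonotoneOn g B) : MonotoneOn g (A ∪ B) := by
  have key : ∀ {C D : Set ℝ}, C.OrdConnected → D.OrdConnected → x ∈ C → x ∈ D →
      MonotoneOn g C → MonotoneOn g D → ∀ y ∈ C, ∀ z ∈ D, y ≤ z → g y ≤ g z := by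
    intro C D hC hD hxC hxD hgC hgD y hy z hz hyz
    rcases le_total z x with hzx | hxz
    · exact hgC hy (hC.out hy hxC ⟨hyz, hzx⟩) hyz
    rcases le_total x y with hxy | hyx
    · exact hgD (hD.out hxD hz ⟨hxy, hyz⟩) hz hyz
    · exact (hgC hy hxC hyx).trans (hgD hxD hz hxz)
  rintro y (hy | hy) z (hz | hz) hyz
  · exact hgA hy hz hyz
  · exact key hA hB hxA hxB hgA hgB y hy z hz hyz
  · exact key hB hA hxB hxA hgB hgA y hy z hz hyz
  · exact hgB hy hz hyz

theorem AntitoneOn.union_of_mem {g : ℝ → ℝ} {A B : Set ℝ} (hA : A.OrdConnected)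
    (hB : B.OrdConnected) {x : ℝ} (hxA : x ∈ A) (hxB : x ∈ B) (hgA : AntitoneOn g A)
    (hgB : AntitoneOn g B) : AntitoneOn g (A ∪ B) := by
  have := MonotoneOn.union_of_mem hA hB hxA hxB hgA.neg hgB.neg
  simpa using this.neg

/-- Two overlapping monotone pieces have a common direction of monotonicity as soon as `g` is
constant on one of them or nonconstant on the intersection. -/
theorem IsMonoPiece.union {g : ℝ → ℝ} {A B : Set ℝ} (hA : IsMonoPiece g A) (hB : IsMonoPiece g B)
    (hne : (A ∩ B).Nonempty)
    (h : (∀ y ∈ A, ∀ z ∈ A, g y = g z) ∨ ∃ y ∈ A ∩ B, ∃ z ∈ A ∩ B, g y ≠ g z) :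
    IsMonoPiece g (A ∪ B) := by
  obtain ⟨x, hxA, hxB⟩ := hne
  refine ⟨union_subset hA.subset hB.subset,
    hA.ordConnected.union_of_mem hB.ordConnected hxA hxB, ?_⟩
  have common : (MonotoneOn g A ∧ MonotoneOn g B) ∨ (AntitoneOn g A ∧ AntitoneOn g B) := by
    rcases h with h | ⟨y, hy, z, hz, hyz⟩
    · have h1 : MonotoneOn g A := fun y hy z hz _ => (h y hy z hz).le
      have h2 : AntitoneOn g A := fun y hy z hz _ => (h y hy z hz).ge
      rcases hB.mono with h3 | h3
      · exact .inl ⟨h1, h3⟩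
      · exact .inr ⟨h2, h3⟩
    · rcases hA.mono with h1 | h1 <;> rcases hB.mono with h2 | h2
      · exact .inl ⟨h1, h2⟩
      · rcases le_total y z with hle | hle
        · exact absurd (le_antisymm (h1 hy.1 hz.1 hle) (h2 hy.2 hz.2 hle)) hyz
        · exact absurd (le_antisymm (h2 hz.2 hy.2 hle) (h1 hz.1 hy.1 hle)) hyz
      · rcases le_total y z with hle | hle
        · exact absurd (le_antisymm (h2 hy.2 hz.2 hle) (h1 hy.1 hz.1 hle)) hyz
        · exact absurd (le_antisymm (h1 hz.1 hy.1 hle) (h2 hz.2 hy.2 hle)) hyz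
      · exact .inr ⟨h1, h2⟩
  exact common.imp
    (fun h => h.1.union_of_mem hA.ordConnected hB.ordConnected hxA hxB h.2)
    (fun h => h.1.union_of_mem hA.ordConnected hB.ordConnected hxA hxB h.2)

theorem IsLap.isMonoPiece {g : ℝ → ℝ} {L : Set ℝ} (hL : IsLap g L) : IsMonoPiece g L :=
  ⟨hL.1, hL.2.1, hL.2.2.2.1⟩

theorem IsLap.eq_of_subset {g : ℝ → ℝ} {L A : Set ℝ} (hL : IsLap g L) (hA : IsMonoPiece g A)
    (h : L ⊆ A) : A = L :=
  hL.2.2.2.2 A hA.subset hA.ordConnected hA.mono h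

theorem IsLap.subset_of_overlap {g : ℝ → ℝ} {L B : Set ℝ} (hL : IsLap g L) (hB : IsMonoPiece g B)
    (hne : (L ∩ B).Nonempty)
    (h : (∀ y ∈ L, ∀ z ∈ L, g y = g z) ∨ ∃ y ∈ L ∩ B, ∃ z ∈ L ∩ B, g y ≠ g z) : B ⊆ L := by
  rw [← hL.eq_of_subset (hL.isMonoPiece.union hB hne h) subset_union_left]
  exact subset_union_right

/-- Every lap contains a member of a given finite monotone cover which determines the lap. -/
theorem IsLap.exists_cover_subset {ι : Type*} [Finite ι] {g : ℝ → ℝ} {J : ι → Set ℝ}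
    (hg : ContinuousOn g (Icc (-1) 1)) (hJ : IsMonoCover g J) {L : Set ℝ} (hL : IsLap g L) :
    ∃ i, J i ⊆ L ∧ (J i).Nonempty ∧
      ((∀ y ∈ L, ∀ z ∈ L, g y = g z) ∨ ∃ y ∈ J i, ∃ z ∈ J i, g y ≠ g z) := by
  by_cases hconst : ∀ y ∈ L, ∀ z ∈ L, g y = g z
  · obtain ⟨x, hx⟩ := hL.2.2.1.nonempty
    obtain ⟨i, hi⟩ := hJ.cover x (hL.1 hx)
    exact ⟨i, hL.subset_of_overlap (hJ.piece i) ⟨x, hx, hi⟩ (.inl hconst), ⟨x, hi⟩, .inl hconst⟩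
  · obtain ⟨i, y, hy, z, hz, hyz⟩ : ∃ i, ∃ y ∈ L ∩ J i, ∃ z ∈ L ∩ J i, g y ≠ g z := by
      by_contra! hcon
      apply hconst
      have himg : g '' L ⊆ ⋃ i, g '' (L ∩ J i) := by
        rintro _ ⟨x, hx, rfl⟩
        obtain ⟨i, hi⟩ := hJ.cover x (hL.1 hx)
        exact mem_iUnion.2 ⟨i, x, ⟨hx, hi⟩, rfl⟩
      have hfin : (g '' L).Finite := by
        refine (finite_iUnion fun i => Subsingleton.finite ?_).subset himg
        rintro _ ⟨y, hy, rfl⟩ _ ⟨z, hz, rfl⟩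
        exact hcon i y hy z hz
      have hpre : IsPreconnected (g '' L) :=
        (isPreconnected_iff_ordConnected.2 hL.2.1).image g (hg.mono hL.1)
      have hsub := hfin.countable.isTotallyDisconnected _ Subset.rfl hpre
      exact fun y hy z hz => hsub (mem_image_of_mem g hy) (mem_image_of_mem g hz)
    exact ⟨i, hL.subset_of_overlap (hJ.piece i) ⟨y, hy⟩ (.inr ⟨y, hy, z, hz, hyz⟩), ⟨y, hy.2⟩,
      .inr ⟨y, hy.2, z, hz.2, hyz⟩⟩

theorem exists_injective_laps {ι : Type*} [Finite ι] {g : ℝ → ℝ} {J : ι → Set ℝ}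
    (hg : ContinuousOn g (Icc (-1) 1)) (hJ : IsMonoCover g J) :
    ∃ φ : {L : Set ℝ // IsLap g L} → ι, Function.Injective φ := by
  choose φ hsub hne hφ using fun L : {L : Set ℝ // IsLap g L} => L.2.exists_cover_subset hg hJ
  refine ⟨φ, fun L L' hLL' => Subtype.ext ?_⟩
  have hsub' : J (φ L) ⊆ L' := hLL' ▸ hsub L'
  obtain ⟨x, hx⟩ := hne L
  refine L'.2.eq_of_subset L.2.isMonoPiece
    (L.2.subset_of_overlap L'.2.isMonoPiece ⟨x, hsub L hx, hsub' hx⟩ ((hφ L).imp_right ?_))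
  rintro ⟨y, hy, z, hz, hyz⟩
  exact ⟨y, ⟨hsub L hy, hsub' hy⟩, z, ⟨hsub L hz, hsub' hz⟩, hyz⟩

theorem finite_laps {ι : Type*} [Finite ι] {g : ℝ → ℝ} {J : ι → Set ℝ}
    (hg : ContinuousOn g (Icc (-1) 1)) (hJ : IsMonoCover g J) : Finite {L : Set ℝ // IsLap g L} :=
  have ⟨φ, hφ⟩ := exists_injective_laps hg hJ
  Finite.of_injective φ hφ

theorem lapNum_le_card {ι : Type*} [Finite ι] {g : ℝ → ℝ} {J : ι → Set ℝ}
    (hg : ContinuousOn g (Icc (-1) 1)) (hJ : IsMonoCover g J) : lapNum g ≤ Nat.card ι :=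
  have ⟨φ, hφ⟩ := exists_injective_laps hg hJ
  Nat.card_le_card_of_injective φ hφ

/-- Every nondegenerate monotone piece extends to a lap. -/
theorem IsMonoPiece.exists_isLap {g : ℝ → ℝ} {A : Set ℝ} (hA : IsMonoPiece g A)
    (hnt : A.Nontrivial) : ∃ L, IsLap g L ∧ A ⊆ L := by
  have hub : ∀ c ⊆ {B | IsMonoPiece g B}, IsChain (· ⊆ ·) c → c.Nonempty →
      ∃ ub ∈ {B | IsMonoPiece g B}, ∀ B ∈ c, B ⊆ ub := by
    intro c hc hchain _
    have hdir : DirectedOn (· ⊆ ·) c := hchain.directedOn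
    refine ⟨⋃₀ c, ⟨sUnion_subset fun B hB => (hc hB).subset, ⟨?_⟩, ?_⟩,
      fun B hB => subset_sUnion_of_mem hB⟩
    · rintro x ⟨B, hB, hx⟩ y ⟨C, hC, hy⟩
      obtain ⟨D, hD, hBD, hCD⟩ := hdir B hB C hC
      exact ((hc hD).ordConnected.out (hBD hx) (hCD hy)).trans (subset_sUnion_of_mem hD)
    · by_contra! hcon
      simp only [MonotoneOn, AntitoneOn, not_forall] at hcon
      obtain ⟨⟨x, ⟨B, hB, hx⟩, y, ⟨C, hC, hy⟩, hxy, h1⟩,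
        ⟨x', ⟨B', hB', hx'⟩, y', ⟨C', hC', hy'⟩, hxy', h2⟩⟩ := hcon
      obtain ⟨D, hD, hBD, hCD⟩ := hdir B hB C hC
      obtain ⟨D', hD', hBD', hCD'⟩ := hdir B' hB' C' hC'
      obtain ⟨E, hE, hDE, hDE'⟩ := hdir D hD D' hD'
      rcases (hc hE).mono with h | h
      · exact h1 (h (hDE (hBD hx)) (hDE (hCD hy)) hxy)
      · exact h2 (h (hDE' (hBD' hx')) (hDE' (hCD' hy')) hxy')
  obtain ⟨L, hAL, hL⟩ := zorn_subset_nonempty _ hub A hA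
  refine ⟨L, ⟨hL.prop.subset, hL.prop.ordConnected, hnt.mono hAL, hL.prop.mono, ?_⟩, hAL⟩
  exact fun L' h1 h2 h3 h => (hL.eq_of_subset ⟨h1, h2, h3⟩ h).symm

/-- Members of a finite cover by order-connected sets fill one-sided neighbourhoods. -/
theorem exists_mem_nhdsGT_of_cover {ι : Type*} [Finite ι] {g : ℝ → ℝ} {J : ι → Set ℝ}
    (hJ : IsMonoCover g J) {x : ℝ} (hx : x ∈ Ico (-1 : ℝ) 1) : ∃ i, J i ∈ 𝓝[>] x := by
  have hev : ∃ᶠ y in 𝓝[>] x, ∃ i, y ∈ J i := by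
    refine Eventually.frequently ?_
    filter_upwards [Ioc_mem_nhdsGT hx.2] with y hy
    exact hJ.cover y ⟨hx.1.trans hy.1.le, hy.2⟩
  obtain ⟨i, hi⟩ : ∃ i, ∃ᶠ y in 𝓝[>] x, y ∈ J i := by
    by_contra! hcon
    exact hev ((eventually_all.2 hcon).mono fun y hy ⟨i, hi⟩ => hy i hi)
  refine ⟨i, ?_⟩
  obtain ⟨z, hzJ, hz⟩ := (hi.and_eventually self_mem_nhdsWithin).exists
  filter_upwards [Ioc_mem_nhdsGT hz] with y hy
  obtain ⟨w, hwJ, hw⟩ := (hi.and_eventually (Ioo_mem_nhdsGT hy.1)).exists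
  exact (hJ.piece i).ordConnected.out hwJ hzJ ⟨hw.2.le, hy.2⟩

theorem exists_mem_nhdsLT_of_cover {ι : Type*} [Finite ι] {g : ℝ → ℝ} {J : ι → Set ℝ}
    (hJ : IsMonoCover g J) {x : ℝ} (hx : x ∈ Ioc (-1 : ℝ) 1) : ∃ i, J i ∈ 𝓝[<] x := by
  have hev : ∃ᶠ y in 𝓝[<] x, ∃ i, y ∈ J i := by
    refine Eventually.frequently ?_
    filter_upwards [Ico_mem_nhdsLT hx.1] with y hy
    exact hJ.cover y ⟨hy.1, hy.2.le.trans hx.2⟩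
  obtain ⟨i, hi⟩ : ∃ i, ∃ᶠ y in 𝓝[<] x, y ∈ J i := by
    by_contra! hcon
    exact hev ((eventually_all.2 hcon).mono fun y hy ⟨i, hi⟩ => hy i hi)
  refine ⟨i, ?_⟩
  obtain ⟨z, hzJ, hz⟩ := (hi.and_eventually self_mem_nhdsWithin).exists
  filter_upwards [Ico_mem_nhdsLT hz] with y hy
  obtain ⟨w, hwJ, hw⟩ := (hi.and_eventually (Ioo_mem_nhdsLT hy.2)).exists
  exact (hJ.piece i).ordConnected.out hzJ hwJ ⟨hy.1, hw.1.le⟩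

/-- A continuous map stays monotone when an end point is added to the interval. -/
theorem IsMonoPiece.insert_of_mem_closure {g : ℝ → ℝ} {A : Set ℝ} (hA : IsMonoPiece g A)
    (hg : ContinuousOn g (Icc (-1) 1)) {x : ℝ} (hx : x ∈ closure A)
    (hxA : (insert x A).OrdConnected) : IsMonoPiece g (insert x A) := by
  have hxI : x ∈ Icc (-1 : ℝ) 1 := closure_minimal hA.subset isClosed_Icc hx
  have hc : ContinuousWithinAt g A x := (hg x hxI).mono hA.subset
  have hcl : ClusterPt x (𝓟 A) := mem_closure_iff_clusterPt.1 hx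
  refine ⟨insert_subset hxI hA.subset, hxA, hA.mono.imp ?_ ?_⟩
  · exact fun h => h.insert_of_continuousWithinAt hcl hc
  · intro h
    simpa using (h.neg.insert_of_continuousWithinAt hcl hc.neg).neg

theorem exists_isLap_mem {ι : Type*} [Finite ι] {g : ℝ → ℝ} {J : ι → Set ℝ}
    (hg : ContinuousOn g (Icc (-1) 1)) (hJ : IsMonoCover g J) {x : ℝ} (hx : x ∈ Icc (-1 : ℝ) 1) :
    ∃ L, IsLap g L ∧ x ∈ L := by
  suffices ∃ A, IsMonoPiece g A ∧ A.Nontrivial ∧ x ∈ A by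
    obtain ⟨A, hA, hnt, hxA⟩ := this
    obtain ⟨L, hL, hAL⟩ := hA.exists_isLap hnt
    exact ⟨L, hL, hAL hxA⟩
  rcases lt_or_ge x 1 with hlt | hge
  · obtain ⟨i, hi⟩ := exists_mem_nhdsGT_of_cover hJ ⟨hx.1, hlt⟩
    obtain ⟨y, hxy, hy⟩ := (mem_nhdsGT_iff_exists_Ioo_subset).1 hi
    have hpiece : IsMonoPiece g (Ioo x y) := ⟨hy.trans (hJ.piece i).subset, ordConnected_Ioo,
      (hJ.piece i).mono.imp (fun h => h.mono hy) (fun h => h.mono hy)⟩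
    have hins : insert x (Ioo x y) = Ico x y := Ioo_insert_left hxy
    have hA := hpiece.insert_of_mem_closure hg (x := x)
      (by rw [closure_Ioo (ne_of_lt hxy)]; exact left_mem_Icc.2 (le_of_lt hxy))
      (by rw [hins]; exact ordConnected_Ico)
    rw [hins] at hA
    obtain ⟨z, hz⟩ := exists_between (show x < y from hxy)
    exact ⟨_, hA, ⟨x, ⟨le_rfl, hxy⟩, z, ⟨hz.1.le, hz.2⟩, hz.1.ne⟩, ⟨le_rfl, hxy⟩⟩
  · obtain ⟨i, hi⟩ := exists_mem_nhdsLT_of_cover hJ (x := x) ⟨by linarith, hx.2⟩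
    obtain ⟨y, hxy, hy⟩ := (mem_nhdsLT_iff_exists_Ioo_subset).1 hi
    have hpiece : IsMonoPiece g (Ioo y x) := ⟨hy.trans (hJ.piece i).subset, ordConnected_Ioo,
      (hJ.piece i).mono.imp (fun h => h.mono hy) (fun h => h.mono hy)⟩
    have hins : insert x (Ioo y x) = Ioc y x := Ioo_insert_right hxy
    have hA := hpiece.insert_of_mem_closure hg (x := x)
      (by rw [closure_Ioo (ne_of_lt hxy)]; exact right_mem_Icc.2 (le_of_lt hxy))
      (by rw [hins]; exact ordConnected_Ioc)
    rw [hins] at hA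
    obtain ⟨z, hz⟩ := exists_between (show y < x from hxy)
    exact ⟨_, hA, ⟨z, ⟨hz.1, hz.2.le⟩, x, ⟨hxy, le_rfl⟩, hz.2.ne⟩, ⟨hxy, le_rfl⟩⟩

theorem isMonoCover_laps {ι : Type*} [Finite ι] {g : ℝ → ℝ} {J : ι → Set ℝ}
    (hg : ContinuousOn g (Icc (-1) 1)) (hJ : IsMonoCover g J) :
    IsMonoCover g (fun L : {L : Set ℝ // IsLap g L} => (L : Set ℝ)) where
  piece L := L.2.isMonoPiece
  cover _ hx := have ⟨L, hL, hxL⟩ := exists_isLap_mem hg hJ hx; ⟨⟨L, hL⟩, hxL⟩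

theorem lapNum_pos {ι : Type*} [Finite ι] {g : ℝ → ℝ} {J : ι → Set ℝ}
    (hg : ContinuousOn g (Icc (-1) 1)) (hJ : IsMonoCover g J) : 0 < lapNum g := by
  have := finite_laps hg hJ
  obtain ⟨L, hL, -⟩ := exists_isLap_mem hg hJ (x := 1) (by simp)
  have : Nonempty {L : Set ℝ // IsLap g L} := ⟨⟨L, hL⟩⟩
  exact Nat.card_pos

theorem IsMonoPiece.comp {g h : ℝ → ℝ} {A B : Set ℝ} (hA : IsMonoPiece g A)
    (hB : IsMonoPiece h B) : IsMonoPiece (h ∘ g) (A ∩ g ⁻¹' B) := by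
  refine ⟨inter_subset_left.trans hA.subset, ⟨?_⟩, ?_⟩
  · rintro x ⟨hxA, hxB⟩ y ⟨hyA, hyB⟩ z hz
    have hzA := hA.ordConnected.out hxA hyA hz
    refine ⟨hzA, ?_⟩
    rcases hA.mono with hm | hm
    · exact hB.ordConnected.out hxB hyB ⟨hm hxA hzA hz.1, hm hzA hyA hz.2⟩
    · exact hB.ordConnected.out hyB hxB ⟨hm hzA hyA hz.2, hm hxA hzA hz.1⟩
  · rcases hA.mono with h1 | h1 <;> rcases hB.mono with h2 | h2
    · exact .inl fun x hx y hy hxy => h2 hx.2 hy.2 (h1 hx.1 hy.1 hxy)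
    · exact .inr fun x hx y hy hxy => h2 hx.2 hy.2 (h1 hx.1 hy.1 hxy)
    · exact .inr fun x hx y hy hxy => h2 hy.2 hx.2 (h1 hx.1 hy.1 hxy)
    · exact .inl fun x hx y hy hxy => h2 hy.2 hx.2 (h1 hx.1 hy.1 hxy)

theorem IsMonoCover.comp {ι κ : Type*} {g h : ℝ → ℝ} {J : ι → Set ℝ} {K : κ → Set ℝ}
    (hJ : IsMonoCover g J) (hK : IsMonoCover h K)
    (hg : MapsTo g (Icc (-1) 1) (Icc (-1) 1)) :
    IsMonoCover (h ∘ g) (fun p : ι × κ => J p.1 ∩ g ⁻¹' K p.2) where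
  piece p := (hJ.piece p.1).comp (hK.piece p.2)
  cover x hx :=
    have ⟨i, hi⟩ := hJ.cover x hx
    have ⟨j, hj⟩ := hK.cover (g x) (hg hx)
    ⟨(i, j), hi, hj⟩

theorem isMonoPiece_id : IsMonoPiece id (Icc (-1) 1) :=
  ⟨Subset.rfl, ordConnected_Icc, .inl monotoneOn_id⟩

theorem PiecewiseMonotone.exists_isMonoCover {f : ℝ → ℝ} (hpm : PiecewiseMonotone f) :
    ∃ (n : ℕ) (J : Fin n → Set ℝ), IsMonoCover f J := by
  obtain ⟨n, a, ha, h0, h1, hmono⟩ := hpm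
  refine ⟨n, fun i => Icc (a i.castSucc) (a i.succ), fun i => ⟨?_, ordConnected_Icc, hmono i⟩, ?_⟩
  · refine Icc_subset_Icc ?_ ?_
    · exact h0 ▸ ha.monotone (Fin.zero_le _)
    · exact h1 ▸ ha.monotone (Fin.le_last _)
  · intro x hx
    by_contra! hcon
    have hstep : ∀ i : Fin n, a i.castSucc ≤ x → a i.succ < x := fun i hi => by
      by_contra! hle
      exact hcon i ⟨hi, hle⟩
    have hall : ∀ i : Fin (n + 1), a i ≤ x := by
      intro i
      induction i using Fin.induction with
      | zero => exact h0 ▸ hx.1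
      | succ i ih => exact (hstep i ih).le
    cases n with
    | zero =>
      have : a 0 = a (Fin.last 0) := rfl
      linarith
    | succ k =>
      have := hstep (Fin.last k) (hall _)
      rw [Fin.succ_last, h1] at this
      exact absurd hx.2 (not_le.2 this)

theorem exists_isMonoCover_iterate {f : ℝ → ℝ} (hm : MapsTo f (Icc (-1) 1) (Icc (-1) 1))
    (hpm : PiecewiseMonotone f) (n : ℕ) :
    ∃ (ι : Type) (_ : Finite ι) (J : ι → Set ℝ), IsMonoCover (f^[n]) J := by
  induction n with
  | zero =>
    exact ⟨Unit, inferInstance, fun _ => Icc (-1) 1, fun _ => isMonoPiece_id, fun _ hx => ⟨(), hx⟩⟩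
  | succ n ih =>
    obtain ⟨ι, _, J, hJ⟩ := ih
    obtain ⟨N, K, hK⟩ := hpm.exists_isMonoCover
    rw [Function.iterate_succ']
    exact ⟨ι × Fin N, inferInstance, _, hJ.comp hK (hm.iterate n)⟩

/-- The points of `[-1,1]` whose first `n` iterates under `g` visit prescribed sets. -/
def itinerarySet (g : ℝ → ℝ) (K : ℕ → Set ℝ) (n : ℕ) : Set ℝ :=
  {y | y ∈ Icc (-1 : ℝ) 1 ∧ ∀ k < n, g^[k] y ∈ K k}

theorem itinerarySet_succ (g : ℝ → ℝ) (K : ℕ → Set ℝ) (n : ℕ) :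
    itinerarySet g K (n + 1) = itinerarySet g K n ∩ g^[n] ⁻¹' K n := by
  ext y
  simp only [itinerarySet, mem_ofPred_eq, mem_inter_iff, mem_preimage, Nat.forall_lt_succ_right,
    and_assoc]

theorem itinerarySet_anti (g : ℝ → ℝ) (K : ℕ → Set ℝ) {k n : ℕ} (h : k ≤ n) :
    itinerarySet g K n ⊆ itinerarySet g K k :=
  fun _ hy => ⟨hy.1, fun j hj => hy.2 j (hj.trans_le h)⟩

theorem isMonoPiece_itinerarySet {g : ℝ → ℝ} {K : ℕ → Set ℝ} {n : ℕ}
    (hK : ∀ k < n, IsMonoPiece g (K k)) : IsMonoPiece (g^[n]) (itinerarySet g K n) := by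
  induction n with
  | zero =>
    have : itinerarySet g K 0 = Icc (-1) 1 := by ext; simp [itinerarySet]
    exact this ▸ isMonoPiece_id
  | succ n ih =>
    rw [itinerarySet_succ, Function.iterate_succ']
    exact (ih fun k hk => hK k (hk.trans n.lt_succ_self)).comp (hK n n.lt_succ_self)

/-- Small balls meet `[-1,1]` inside the union of three members of a finite monotone cover. -/
theorem IsMonoCover.exists_three_cover {ι : Type*} [Finite ι] {g : ℝ → ℝ} {J : ι → Set ℝ}
    (hJ : IsMonoCover g J) : ∃ ε > 0, ∃ t : ℝ → Fin 3 → ι,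
      ∀ x, ∀ y ∈ Icc (-1 : ℝ) 1, dist y x < ε → ∃ j, y ∈ J (t x j) := by
  let U : (Fin 3 → ι) → Set ℝ := fun t =>
    {y | ∀ᶠ z in 𝓝 y, z ∈ Icc (-1 : ℝ) 1 → ∃ j, z ∈ J (t j)}
  have hopen : ∀ t, IsOpen (U t) := fun t => isOpen_setOfPred_eventually_nhds
  have hcov : Icc (-1 : ℝ) 1 ⊆ ⋃ t, U t := by
    intro x hx
    obtain ⟨i, hi⟩ := hJ.cover x hx
    obtain ⟨r, hr⟩ : ∃ r, ∀ᶠ z in 𝓝[>] x, z ∈ Icc (-1 : ℝ) 1 → z ∈ J r := by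
      rcases lt_or_ge x 1 with hlt | hge
      · obtain ⟨r, hr⟩ := exists_mem_nhdsGT_of_cover hJ ⟨hx.1, hlt⟩
        exact ⟨r, mem_of_superset hr fun z hz _ => hz⟩
      · refine ⟨i, ?_⟩
        filter_upwards [self_mem_nhdsWithin] with z hz hz'
        exact absurd hz'.2 (not_le.2 (hge.trans_lt hz))
    obtain ⟨l, hl⟩ : ∃ l, ∀ᶠ z in 𝓝[<] x, z ∈ Icc (-1 : ℝ) 1 → z ∈ J l := by
      rcases lt_or_ge (-1) x with hlt | hge
      · obtain ⟨l, hl⟩ := exists_mem_nhdsLT_of_cover hJ ⟨hlt, hx.2⟩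
        exact ⟨l, mem_of_superset hl fun z hz _ => hz⟩
      · refine ⟨i, ?_⟩
        filter_upwards [self_mem_nhdsWithin] with z hz hz'
        exact absurd hz'.1 (not_le.2 (lt_of_lt_of_le hz hge))
    refine mem_iUnion.2 ⟨![l, i, r], ?_⟩
    filter_upwards [eventually_nhdsWithin_iff.1 hr, eventually_nhdsWithin_iff.1 hl]
      with z hzr hzl hz
    rcases lt_trichotomy z x with h | rfl | h
    · exact ⟨0, hzl h hz⟩
    · exact ⟨1, hi⟩
    · exact ⟨2, hzr h hz⟩
  obtain ⟨δ, hδ, hball⟩ := lebesgue_number_lemma_of_metric isCompact_Icc hopen hcov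
  have hex : ∀ x, ∃ t : Fin 3 → ι, ∀ y ∈ Icc (-1 : ℝ) 1, dist y x < δ / 2 → ∃ j, y ∈ J (t j) := by
    intro x
    by_cases h : ∃ y ∈ Icc (-1 : ℝ) 1, dist y x < δ / 2
    · obtain ⟨y₀, hy₀, hd⟩ := h
      obtain ⟨t, ht⟩ := hball y₀ hy₀
      refine ⟨t, fun y hy hyx => (ht ?_ : ∀ᶠ z in 𝓝 y, _).self_of_nhds hy⟩
      have := dist_triangle_right y y₀ x
      rw [Metric.mem_ball]
      linarith
    · obtain ⟨i, -⟩ := hJ.cover 1 (by simp)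
      exact ⟨fun _ => i, fun y hy hyx => absurd ⟨y, hy, hyx⟩ h⟩
  choose t ht using hex
  exact ⟨δ / 2, half_pos hδ, t, ht⟩

theorem lapNum_iterate_le_of_isDynCoverOf {ι : Type*} [Finite ι] {g : ℝ → ℝ} {J : ι → Set ℝ}
    (hc : ContinuousOn g (Icc (-1) 1)) (hm : MapsTo g (Icc (-1) 1) (Icc (-1) 1))
    (hJ : IsMonoCover g J) {ε : ℝ} {t : ℝ → Fin 3 → ι}
    (ht : ∀ x, ∀ y ∈ Icc (-1 : ℝ) 1, dist y x < ε → ∃ j, y ∈ J (t x j)) {n : ℕ} {s : Finset ℝ}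
    (hs : Dynamics.IsDynCoverOf g (Icc (-1) 1) {p | dist p.1 p.2 < ε} n s) :
    lapNum (g^[n]) ≤ s.card * 3 ^ n := by
  let K : s × (Fin n → Fin 3) → ℕ → Set ℝ := fun p k =>
    if h : k < n then J (t (g^[k] p.1) (p.2 ⟨k, h⟩)) else ∅
  have hcover : IsMonoCover (g^[n]) (fun p => itinerarySet g (K p) n) := by
    refine ⟨fun p => isMonoPiece_itinerarySet fun k hk => ?_, fun y hy => ?_⟩
    · simp only [K, dif_pos hk]
      exact hJ.piece _
    · obtain ⟨x, hx, hyx⟩ := hs hy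
      rw [Dynamics.mem_dynEntourage] at hyx
      have hex : ∀ k : Fin n, ∃ j, g^[k] y ∈ J (t (g^[k] x) j) := fun k =>
        ht _ _ (hm.iterate k hy) (hyx k k.2)
      choose w hw using hex
      refine ⟨(⟨x, hx⟩, w), hy, fun k hk => ?_⟩
      simp only [K, dif_pos hk]
      exact hw ⟨k, hk⟩
  refine (lapNum_le_card (hc.iterate hm n) hcover).trans_eq ?_
  simp

/-- Finitely many functions that are monotone on `A` and bounded by `1` vary simultaneously by less
than `δ` on each class of a partition of `A` into few classes. -/
theorem exists_floor_key {A : Set ℝ} {u : ℕ → ℝ → ℝ} {n : ℕ}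
    (hu : ∀ k < n, MonotoneOn (u k) A ∨ AntitoneOn (u k) A)
    (hb : ∀ k < n, ∀ y ∈ A, |u k y| ≤ 1) {δ : ℝ} (hδ : 0 < δ) :
    ∃ q : ℝ → ℤ, (∀ y ∈ A, q y ∈ Finset.Icc (-(⌈n / δ⌉₊ : ℤ)) ⌈n / δ⌉₊) ∧
      ∀ y ∈ A, ∀ z ∈ A, q y = q z → ∀ k < n, dist (u k y) (u k z) < δ := by
  have hsign : ∀ k, ∃ σ : ℝ, |σ| = 1 ∧ (k < n → MonotoneOn (fun y => σ * u k y) A) := by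
    intro k
    by_cases hk : k < n
    · rcases hu k hk with h | h
      · exact ⟨1, by simp, fun _ => by simpa using h⟩
      · exact ⟨-1, by simp, fun _ => by simpa using h.neg⟩
    · exact ⟨1, by simp, fun h => absurd h hk⟩
  choose σ hσ hmono using hsign
  let Φ : ℝ → ℝ := fun y => ∑ k ∈ Finset.range n, σ k * u k y
  refine ⟨fun y => ⌊Φ y / δ⌋, fun y hy => ?_, fun y hy z hz hyz k hk => ?_⟩
  · have hΦ : |Φ y| ≤ n := by
      refine (Finset.abs_sum_le_sum_abs _ _).trans ?_
      refine (Finset.sum_le_card_nsmul _ _ 1 fun k hk => ?_).trans_eq (by simp)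
      rw [abs_mul, hσ, one_mul]
      exact hb k (Finset.mem_range.1 hk) y hy
    have hle : |Φ y / δ| ≤ ⌈n / δ⌉₊ := by
      rw [abs_div, abs_of_pos hδ]
      exact (div_le_div_of_nonneg_right hΦ hδ.le).trans (Nat.le_ceil _)
    rw [Finset.mem_Icc, Int.le_floor]
    refine ⟨by push_cast; exact (abs_le.1 hle).1, ?_⟩
    have := (Int.floor_le (Φ y / δ)).trans (abs_le.1 hle).2
    exact_mod_cast this
  · have hclose : |Φ y - Φ z| < δ := by
      have := Int.abs_sub_lt_one_of_floor_eq_floor hyz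
      rwa [← sub_div, abs_div, abs_of_pos hδ, div_lt_one hδ] at this
    have key : ∀ y ∈ A, ∀ z ∈ A, y ≤ z → dist (u k y) (u k z) ≤ |Φ y - Φ z| := by
      intro y hy z hz hle
      have hdiff : Φ z - Φ y = ∑ k ∈ Finset.range n, (σ k * u k z - σ k * u k y) := by
        simp [Φ, Finset.sum_sub_distrib]
      have hsingle := Finset.single_le_sum (f := fun k => σ k * u k z - σ k * u k y)
        (fun j hj => sub_nonneg.2 (hmono j (Finset.mem_range.1 hj) hy hz hle))
        (Finset.mem_range.2 hk)
      rw [dist_comm, Real.dist_eq, abs_sub_comm (Φ y), hdiff]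
      calc |u k z - u k y| = |σ k * u k z - σ k * u k y| := by
            rw [← mul_sub, abs_mul, hσ, one_mul]
        _ = σ k * u k z - σ k * u k y := abs_of_nonneg (sub_nonneg.2 (hmono k hk hy hz hle))
        _ ≤ _ := hsingle
        _ ≤ _ := le_abs_self _
    rcases le_total y z with hle | hle
    · exact (key y hy z hz hle).trans_lt hclose
    · rw [dist_comm]
      exact (key z hz y hy hle).trans_lt (by rwa [abs_sub_comm])

theorem exists_isCover_card_le {X β : Type*} {W : SetRel X X} {F : Set X} (hF : F.Nonempty)
    {κ : X → β} {T : Finset β} (hκ : MapsTo κ F T)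
    (hW : ∀ y ∈ F, ∀ z ∈ F, κ y = κ z → (y, z) ∈ W) :
    ∃ s : Finset X, s.card ≤ T.card ∧ SetRel.IsCover W F s := by
  classical
  have : Nonempty X := ⟨hF.some⟩
  refine ⟨T.image (Function.invFunOn κ F), Finset.card_image_le, fun y hy => ?_⟩
  have hex : ∃ z ∈ F, κ z = κ y := ⟨y, hy, rfl⟩
  exact ⟨Function.invFunOn κ F (κ y), Finset.mem_coe.2 (Finset.mem_image_of_mem _ (hκ hy)),
    hW y hy _ (Function.invFunOn_mem hex) (Function.invFunOn_eq hex).symm⟩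

/-- A monotone cover of `g` yields dynamical covers of `g` of controlled cardinality. -/
theorem IsMonoCover.exists_isDynCoverOf {ι : Type*} [Finite ι] {g : ℝ → ℝ} {J : ι → Set ℝ}
    (hJ : IsMonoCover g J) (hm : MapsTo g (Icc (-1) 1) (Icc (-1) 1)) {δ : ℝ} (hδ : 0 < δ) (n : ℕ) :
    ∃ s : Finset ℝ, s.card ≤ Nat.card ι ^ n * (2 * ⌈n / δ⌉₊ + 1) ∧
      SetRel.IsCover {p : ℝ × ℝ | p.1 ∈ Icc (-1 : ℝ) 1 ∧ p.2 ∈ Icc (-1 : ℝ) 1 ∧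
        ∀ k < n, dist (g^[k] p.1) (g^[k] p.2) < δ} (Icc (-1) 1) s := by
  classical
  have := Fintype.ofFinite ι
  let K : (Fin n → ι) → ℕ → Set ℝ := fun w k => if h : k < n then J (w ⟨k, h⟩) else ∅
  have hmono : ∀ w, ∀ k < n, MonotoneOn (g^[k]) (itinerarySet g (K w) n) ∨
      AntitoneOn (g^[k]) (itinerarySet g (K w) n) := by
    intro w k hk
    have hsub := itinerarySet_anti g (K w) hk.le
    have hpiece : IsMonoPiece (g^[k]) (itinerarySet g (K w) k) := by
      refine isMonoPiece_itinerarySet fun j hj => ?_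
      simp only [K, dif_pos (hj.trans hk)]
      exact hJ.piece _
    exact hpiece.mono.imp (fun h => h.mono hsub) (fun h => h.mono hsub)
  have hbound : ∀ w, ∀ k < n, ∀ y ∈ itinerarySet g (K w) n, |g^[k] y| ≤ 1 :=
    fun w k _ y hy => abs_le.2 (hm.iterate k hy.1)
  choose q hq hqclose using fun w => exists_floor_key (hmono w) (hbound w) hδ
  have hword : ∀ y, ∃ w : Fin n → ι, y ∈ Icc (-1 : ℝ) 1 → y ∈ itinerarySet g (K w) n := by
    intro y
    by_cases hy : y ∈ Icc (-1 : ℝ) 1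
    · choose w hw using fun k : Fin n => hJ.cover _ (hm.iterate k hy)
      refine ⟨w, fun _ => ⟨hy, fun k hk => ?_⟩⟩
      simp only [K, dif_pos hk]
      exact hw ⟨k, hk⟩
    · obtain ⟨i, -⟩ := hJ.cover 1 (by simp)
      exact ⟨fun _ => i, fun h => absurd h hy⟩
  choose w hw using hword
  let T : Finset ((Fin n → ι) × ℤ) :=
    Finset.univ ×ˢ Finset.Icc (-(⌈n / δ⌉₊ : ℤ)) ⌈n / δ⌉₊
  obtain ⟨s, hs, hcov⟩ := exists_isCover_card_le (F := Icc (-1 : ℝ) 1) (by simp)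
    (κ := fun y => (w y, q (w y) y)) (T := T)
    (W := {p : ℝ × ℝ | p.1 ∈ Icc (-1 : ℝ) 1 ∧ p.2 ∈ Icc (-1 : ℝ) 1 ∧
        ∀ k < n, dist (g^[k] p.1) (g^[k] p.2) < δ})
    (fun y hy => by simpa [T] using hq _ y (hw y hy))
    (fun y hy z hz hyz => by
      obtain ⟨h1, h2⟩ := Prod.mk.inj hyz
      refine ⟨hy, hz, hqclose (w y) y (hw y hy) z (h1 ▸ hw z hz) ?_⟩
      rw [h2, h1])
  refine ⟨s, hs.trans_eq ?_, hcov⟩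
  simp only [T, Finset.card_product, Finset.card_univ, Fintype.card_pi_const, Int.card_Icc,
    Nat.card_eq_fintype_card]
  congr 1
  lia

theorem exists_dist_iterate_lt {f : ℝ → ℝ} (hc : ContinuousOn f (Icc (-1) 1))
    (hm : MapsTo f (Icc (-1) 1) (Icc (-1) 1)) {ε : ℝ} (hε : 0 < ε) (m : ℕ) :
    ∃ δ > 0, ∀ x ∈ Icc (-1 : ℝ) 1, ∀ y ∈ Icc (-1 : ℝ) 1, dist x y < δ →
      ∀ r < m, dist (f^[r] x) (f^[r] y) < ε := by
  induction m with
  | zero => exact ⟨1, one_pos, by simp⟩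
  | succ m ih =>
    obtain ⟨δ₁, hδ₁, h₁⟩ := ih
    obtain ⟨δ₂, hδ₂, h₂⟩ := Metric.uniformContinuousOn_iff.1
      (isCompact_Icc.uniformContinuousOn_of_continuous (hc.iterate hm m)) ε hε
    refine ⟨min δ₁ δ₂, lt_min hδ₁ hδ₂, fun x hx y hy hxy r hr => ?_⟩
    rcases Nat.lt_succ_iff_lt_or_eq.1 hr with hr | rfl
    · exact h₁ x hx y hy (hxy.trans_le (min_le_left _ _)) r hr
    · exact h₂ x hx y hy (hxy.trans_le (min_le_right _ _))

theorem lapNum_iterate_add_le {f : ℝ → ℝ} (hc : ContinuousOn f (Icc (-1) 1))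
    (hm : MapsTo f (Icc (-1) 1) (Icc (-1) 1)) (hpm : PiecewiseMonotone f) (m n : ℕ) :
    lapNum (f^[m + n]) ≤ lapNum (f^[m]) * lapNum (f^[n]) := by
  obtain ⟨ι, _, J, hJ⟩ := exists_isMonoCover_iterate hm hpm m
  obtain ⟨κ, _, K, hK⟩ := exists_isMonoCover_iterate hm hpm n
  have := finite_laps (hc.iterate hm m) hJ
  have := finite_laps (hc.iterate hm n) hK
  have hcomp := (isMonoCover_laps (hc.iterate hm m) hJ).comp
    (isMonoCover_laps (hc.iterate hm n) hK) (hm.iterate m)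
  rw [← Function.iterate_add, add_comm n m] at hcomp
  exact (lapNum_le_card (hc.iterate hm (m + n)) hcomp).trans_eq (Nat.card_prod _ _)

theorem lapNum_iterate_pos {f : ℝ → ℝ} (hc : ContinuousOn f (Icc (-1) 1))
    (hm : MapsTo f (Icc (-1) 1) (Icc (-1) 1)) (hpm : PiecewiseMonotone f) (n : ℕ) :
    0 < lapNum (f^[n]) :=
  have ⟨_, _, _, hJ⟩ := exists_isMonoCover_iterate hm hpm n
  lapNum_pos (hc.iterate hm n) hJ

theorem exists_isDynCoverOf_card_le {f : ℝ → ℝ} (hc : ContinuousOn f (Icc (-1) 1))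
    (hm : MapsTo f (Icc (-1) 1) (Icc (-1) 1)) (hpm : PiecewiseMonotone f) {V : SetRel ℝ ℝ}
    (hV : V ∈ uniformity ℝ) (m : ℕ) :
    ∃ δ > (0 : ℝ), ∀ n : ℕ, ∃ s : Finset ℝ,
      s.card ≤ lapNum (f^[m]) ^ n * (2 * ⌈n / δ⌉₊ + 1) ∧
        Dynamics.IsDynCoverOf f (Icc (-1) 1) V (m * n) s := by
  obtain ⟨ε, hε, hεV⟩ := Metric.mem_uniformity_dist.1 hV
  obtain ⟨δ, hδ, hδε⟩ := exists_dist_iterate_lt hc hm hε m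
  obtain ⟨ι, _, J, hJ⟩ := exists_isMonoCover_iterate hm hpm m
  have := finite_laps (hc.iterate hm m) hJ
  refine ⟨δ, hδ, fun n => ?_⟩
  obtain ⟨s, hs, hcov⟩ := (isMonoCover_laps (hc.iterate hm m) hJ).exists_isDynCoverOf
    (hm.iterate m) hδ n
  refine ⟨s, hs, hcov.mono_entourage ?_⟩
  rintro ⟨x, y⟩ ⟨hx, hy, hxy⟩
  rw [Dynamics.mem_dynEntourage]
  intro k hk
  have hm0 : 0 < m := Nat.pos_of_mul_pos_right (k.zero_le.trans_lt hk)
  have hk' : f^[k] = f^[k % m] ∘ (f^[m])^[k / m] := by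
    rw [← Function.iterate_mul, ← Function.iterate_add, Nat.mod_add_div]
  have hmaps := (hm.iterate m).iterate (k / m)
  rw [hk']
  exact hεV (hδε _ (hmaps hx) _ (hmaps hy) (hxy _ (Nat.div_lt_of_lt_mul hk)) _ (Nat.mod_lt _ hm0))

theorem tendsto_log_mul_pow_div (m : ℕ) (hm : m ≠ 0) {L C : ℝ} (hL : 0 < L) (hC : 0 < C) :
    Tendsto (fun n : ℕ => Real.log (L ^ n * (C * n)) / (m * n : ℝ)) atTop
      (𝓝 (Real.log L / m)) := by
  have hm' : (m : ℝ) ≠ 0 := by exact_mod_cast hm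
  have hlog : Tendsto (fun n : ℕ => Real.log n / (n : ℝ)) atTop (𝓝 0) :=
    Real.isLittleO_log_id_atTop.tendsto_div_nhds_zero.comp tendsto_natCast_atTop_atTop
  have hconst : Tendsto (fun n : ℕ => Real.log C / (n : ℝ)) atTop (𝓝 0) :=
    tendsto_const_div_atTop_nhds_zero_nat _
  have hsum := ((hconst.add hlog).div_const (m : ℝ)).const_add (Real.log L / m)
  simp only [add_zero, zero_div] at hsum
  refine hsum.congr' ?_
  filter_upwards [eventually_ne_atTop 0] with n hn
  have hn' : (n : ℝ) ≠ 0 := by exact_mod_cast hn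
  rw [Real.log_mul (by positivity) (by positivity), Real.log_mul hC.ne' hn', Real.log_pow]
  field_simp

theorem htop_le_log_lapNum_div {f : ℝ → ℝ} (hc : ContinuousOn f (Icc (-1) 1))
    (hm : MapsTo f (Icc (-1) 1) (Icc (-1) 1)) (hpm : PiecewiseMonotone f) {m : ℕ} (hm0 : m ≠ 0) :
    htop f ≤ ((Real.log (lapNum (f^[m])) / m : ℝ) : EReal) := by
  refine iSup₂_le fun U hU => ?_
  obtain ⟨V, hV, hsymm, hVU⟩ := comp_symm_mem_uniformity_sets hU
  obtain ⟨δ, hδ, hcov⟩ := exists_isDynCoverOf_card_le hc hm hpm hV m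
  have hL : (0 : ℝ) < lapNum (f^[m]) := by exact_mod_cast lapNum_iterate_pos hc hm hpm m
  have hC : 0 < 2 / δ + 3 := by positivity
  refine ge_of_tendsto (continuous_coe_real_ereal.continuousAt.tendsto.comp
    (tendsto_log_mul_pow_div m hm0 hL hC)) ?_
  filter_upwards [eventually_ge_atTop 1] with n hn
  obtain ⟨s, hs, hsc⟩ := hcov n
  refine (Dynamics.coverEntropyEntourage_antitone f _ hVU).trans
    ((hsc.coverEntropyEntourage_le_log_card_div hm (Nat.mul_ne_zero hm0 (by lia))).trans ?_)
  have hn' : (1 : ℝ) ≤ n := by exact_mod_cast hn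
  have hcard : (s.card : ℝ) ≤ lapNum (f^[m]) ^ n * ((2 / δ + 3) * n) := by
    have h1 : (s.card : ℝ) ≤ lapNum (f^[m]) ^ n * (2 * ⌈n / δ⌉₊ + 1) := by exact_mod_cast hs
    refine h1.trans (mul_le_mul_of_nonneg_left ?_ (by positivity))
    have h2 : (⌈n / δ⌉₊ : ℝ) < n / δ + 1 := Nat.ceil_lt_add_one (by positivity)
    have h3 : (2 / δ + 3) * n = 2 * (n / δ) + 3 * n := by ring
    linarith
  have hlog : ENNReal.log (s.card : ENNReal) ≤
      (Real.log (lapNum (f^[m]) ^ n * ((2 / δ + 3) * n)) : ℝ) := by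
    rw [← ENNReal.log_ofReal_of_pos (by positivity), ← ENNReal.ofReal_natCast]
    exact ENNReal.log_monotone (ENNReal.ofReal_le_ofReal hcard)
  refine (EReal.div_le_div_right_of_nonneg (by positivity) hlog).trans_eq ?_
  simp only [Function.comp_apply, EReal.coe_div, EReal.coe_mul, EReal.coe_natCast, EReal.natCast_mul]

theorem eventually_lapNum_iterate_mul_le {f : ℝ → ℝ} (hc : ContinuousOn f (Icc (-1) 1))
    (hm : MapsTo f (Icc (-1) 1) (Icc (-1) 1)) (hpm : PiecewiseMonotone f) {h : ℝ}
    (hh : htop f < h) (m : ℕ) (hm0 : m ≠ 0) :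
    ∀ᶠ n : ℕ in atTop, (lapNum (f^[m * n]) : ℝ) ≤ Real.exp (h * (m * n)) * 3 ^ n := by
  obtain ⟨ι, _, J, hJ⟩ := exists_isMonoCover_iterate hm hpm m
  obtain ⟨ε, hε, t, ht⟩ := hJ.exists_three_cover
  have hent : Dynamics.coverEntropyEntourage f (Icc (-1) 1) {p | dist p.1 p.2 < ε} < h :=
    (Dynamics.coverEntropyEntourage_le_coverEntropy f _ (Metric.dist_mem_uniformity hε)).trans_lt hh
  have hev := (tendsto_id.const_mul_atTop' (Nat.pos_of_ne_zero hm0)).eventually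
    (ExpGrowth.eventually_le_exp hent)
  filter_upwards [hev] with n hn
  have hfin : Dynamics.coverMincard f (Icc (-1) 1) {p | dist p.1 p.2 < ε} (m * n) < ⊤ := by
    rw [← ENat.toENNReal_lt_top]
    refine lt_of_le_of_lt hn ?_
    rw [EReal.exp_lt_top_iff]
    exact_mod_cast EReal.coe_lt_top (h * (m * n : ℕ))
  obtain ⟨s, hs, hcard⟩ := (Dynamics.coverMincard_finite_iff _ _ _ _).1 hfin
  have hexp : (s.card : ℝ) ≤ Real.exp (h * (m * n)) := by
    rw [← ENNReal.ofReal_le_ofReal_iff (Real.exp_pos _).le, ENNReal.ofReal_natCast,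
      ← EReal.exp_coe]
    simpa [← hcard] using hn
  have hdyn : Dynamics.IsDynCoverOf (f^[m]) (Icc (-1) 1) {p | dist p.1 p.2 < ε} n s := by
    refine SetRel.IsCover.mono_entourage ?_ hs
    rintro ⟨x, y⟩ hxy
    rw [Dynamics.mem_dynEntourage] at hxy ⊢
    intro k hk
    rw [← Function.iterate_mul]
    exact hxy _ (Nat.mul_lt_mul_of_pos_left hk (Nat.pos_of_ne_zero hm0))
  have hlap := lapNum_iterate_le_of_isDynCoverOf (hc.iterate hm m) (hm.iterate m) hJ ht hdyn
  rw [← Function.iterate_mul] at hlap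
  calc (lapNum (f^[m * n]) : ℝ) ≤ s.card * 3 ^ n := by exact_mod_cast hlap
    _ ≤ _ := by gcongr

theorem subadditive_log_lapNum {f : ℝ → ℝ} (hc : ContinuousOn f (Icc (-1) 1))
    (hm : MapsTo f (Icc (-1) 1) (Icc (-1) 1)) (hpm : PiecewiseMonotone f) :
    Subadditive fun n => Real.log (lapNum (f^[n])) := by
  intro m n
  have hpos : ∀ k, (0 : ℝ) < lapNum (f^[k]) := fun k =>
    by exact_mod_cast lapNum_iterate_pos hc hm hpm k
  rw [← Real.log_mul (hpos m).ne' (hpos n).ne']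
  exact Real.log_le_log (hpos _) (by exact_mod_cast lapNum_iterate_add_le hc hm hpm m n)

theorem le_of_htop_lt {f : ℝ → ℝ} (hc : ContinuousOn f (Icc (-1) 1))
    (hm : MapsTo f (Icc (-1) 1) (Icc (-1) 1)) (hpm : PiecewiseMonotone f) {s h : ℝ}
    (hs : Tendsto (fun n : ℕ => Real.log (lapNum (f^[n])) / n) atTop (𝓝 s)) (hh : htop f < h) :
    s ≤ h := by
  have hle : ∀ m : ℕ, m ≠ 0 → s ≤ h + Real.log 3 / m := by
    intro m hm0
    have hmul : Tendsto (fun n : ℕ => m * n) atTop atTop :=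
      tendsto_id.const_mul_atTop' (Nat.pos_of_ne_zero hm0)
    refine le_of_tendsto (hs.comp hmul) ?_
    filter_upwards [eventually_lapNum_iterate_mul_le hc hm hpm hh m hm0, eventually_gt_atTop 0]
      with n hn hn0
    have hpos : (0 : ℝ) < lapNum (f^[m * n]) := by
      exact_mod_cast lapNum_iterate_pos hc hm hpm (m * n)
    have hlog := Real.log_le_log hpos hn
    rw [Real.log_mul (Real.exp_pos _).ne' (by positivity), Real.log_exp, Real.log_pow] at hlog
    have hm' : (0 : ℝ) < m := by exact_mod_cast Nat.pos_of_ne_zero hm0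
    have hn' : (0 : ℝ) < n := by exact_mod_cast hn0
    simp only [Function.comp_apply, Nat.cast_mul]
    rw [div_le_iff₀ (by positivity)]
    refine hlog.trans_eq ?_
    field_simp
  refine ge_of_tendsto (f := fun m : ℕ => h + Real.log 3 / m) (x := atTop) ?_
    ((eventually_ne_atTop 0).mono hle)
  simpa using (tendsto_const_div_atTop_nhds_zero_nat (Real.log 3)).const_add h

/-- Misiurewicz–Szlenk: for a continuous piecewise monotone map `f` of `[-1,1]`,
the limit `lim (1/n)·log ℓ(fⁿ)` exists and equals the topological entropy of `f`. -/
theorem lap_number_limit_eq_entropy (f : ℝ → ℝ)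
    (hc : ContinuousOn f (Set.Icc (-1) 1))
    (hm : Set.MapsTo f (Set.Icc (-1) 1) (Set.Icc (-1) 1))
    (hpm : PiecewiseMonotone f) :
    Filter.Tendsto (fun n : ℕ => (((1 / (n : ℝ)) * Real.log (lapNum (f^[n])) : ℝ) : EReal))
      Filter.atTop (nhds (htop f)) := by
  have hsub := subadditive_log_lapNum hc hm hpm
  have hbdd : BddBelow (range fun n : ℕ => Real.log (lapNum (f^[n])) / n) :=
    ⟨0, by rintro _ ⟨n, rfl⟩; exact div_nonneg (Real.log_natCast_nonneg _) n.cast_nonneg⟩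
  have hlim := hsub.tendsto_lim hbdd
  have hlim' : Tendsto (fun n : ℕ => ((Real.log (lapNum (f^[n])) / n : ℝ) : EReal)) atTop
      (𝓝 (hsub.lim : EReal)) := continuous_coe_real_ereal.continuousAt.tendsto.comp hlim
  have heq : htop f = hsub.lim := by
    refine le_antisymm (ge_of_tendsto hlim' ?_) (EReal.le_of_forall_lt_iff_le.1 fun h hh => ?_)
    · filter_upwards [eventually_ne_atTop 0] with n hn
      exact htop_le_log_lapNum_div hc hm hpm hn
    · exact EReal.coe_le_coe_iff.2 (le_of_htop_lt hc hm hpm hlim hh)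
  rw [heq]
  refine hlim'.congr fun n => ?_
  rw [div_eq_mul_inv, mul_comm, one_div]
end

section
/- Let g : [−1,1] → [−1,1] be a continuous b-modal map (a piecewise monotone map with exactly b turning points) whose topological entropy satisfies h_top(g) = log s for some s > 1. Then there exist an integer b′ ≤ b, a piecewise linear map f : [−1,1] → [−1,1] with at most b′ turning points and constant slope ±s, and a continuous monotone non-decreasing surjection H : [−1,1] → [−1,1] such that H∘g = f∘H. -/
/-- `g` is `b`-modal: `[-1,1]` splits into `b+1` intervals of strict monotonicity,
with directions alternating (so `g` has exactly `b` interior turning points). -/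
def BModal (b : ℕ) (g : ℝ → ℝ) : Prop :=
  ∃ c : Fin (b + 2) → ℝ, StrictMono c ∧ c 0 = -1 ∧ c (Fin.last (b + 1)) = 1 ∧
    ∃ σ : Bool, ∀ i : Fin (b + 1),
      ((Even (i : ℕ) ↔ σ = true) → StrictMonoOn g (Set.Icc (c i.castSucc) (c i.succ))) ∧
      (¬(Even (i : ℕ) ↔ σ = true) → StrictAntiOn g (Set.Icc (c i.castSucc) (c i.succ)))

open Set Filter Topology

/-- A continuous self-map `g` of `[-1,1]` which is strictly monotone on every interval
whose interior avoids the finite set `C`. -/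
structure PiecewiseStrictMono (g : ℝ → ℝ) (C : Finset ℝ) : Prop where
  continuousOn : ContinuousOn g (Icc (-1) 1)
  mapsTo : MapsTo g (Icc (-1) 1) (Icc (-1) 1)
  strict : ∀ x ∈ Icc (-1 : ℝ) 1, ∀ y ∈ Icc (-1 : ℝ) 1, x < y → (∀ z ∈ Ioo x y, z ∉ C) →
    StrictMonoOn g (Icc x y) ∨ StrictAntiOn g (Icc x y)

/-- The points of `[-1,1]` whose orbit of length `n` meets `C`. -/
def hitSet (g : ℝ → ℝ) (C : Finset ℝ) (n : ℕ) : Set ℝ :=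
  {x | x ∈ Icc (-1 : ℝ) 1 ∧ ∃ k < n, g^[k] x ∈ C}

/-- The points of `[-1,1]` sent into `D` by the `n`-th iterate. -/
def preimSet (g : ℝ → ℝ) (n : ℕ) (D : Finset ℝ) : Set ℝ :=
  {x | x ∈ Icc (-1 : ℝ) 1 ∧ g^[n] x ∈ D}

theorem hitSet_succ (g : ℝ → ℝ) (C : Finset ℝ) (n : ℕ) :
    hitSet g C (n + 1) = hitSet g C n ∪ preimSet g n C := by
  ext x
  simp only [hitSet, preimSet, mem_union, mem_ofPred_eq, Nat.lt_succ_iff_lt_or_eq]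
  grind

theorem hitSet_mono (g : ℝ → ℝ) (C : Finset ℝ) : Monotone (hitSet g C) := by
  rintro m n hmn x ⟨hx, k, hk, h⟩
  exact ⟨hx, k, hk.trans_le hmn, h⟩

/-- If the fibres of `φ` on `S` are separated by points of `T`, then `S` is finite and
its cardinality is bounded in terms of those of `φ '' S` and `T`. -/
theorem finite_ncard_le_of_separated {S T : Set ℝ} {φ : ℝ → ℝ} {D : Set ℝ} (hT : T.Finite)
    (hD : D.Finite) (hφ : MapsTo φ S D)
    (hsep : ∀ x ∈ S, ∀ y ∈ S, x < y → φ x = φ y → ∃ t ∈ T, x < t ∧ t < y) :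
    S.Finite ∧ S.ncard ≤ D.ncard * (T.ncard + 1) := by
  classical
  lift T to Finset ℝ using hT
  lift D to Finset ℝ using hD
  set ψ : ℝ → ℝ × ℕ := fun x => (φ x, (T.filter (· < x)).card) with hψ
  have hmaps : MapsTo ψ S ((D ×ˢ Finset.range (T.card + 1) : Finset (ℝ × ℕ)) : Set (ℝ × ℕ)) := by
    intro x hx
    simp only [hψ, Finset.coe_product, mem_prod, Finset.mem_coe, Finset.mem_range,
      Nat.lt_succ_iff]
    exact ⟨hφ hx, Finset.card_filter_le _ _⟩
  have key : ∀ x ∈ S, ∀ y ∈ S, x < y → ψ x ≠ ψ y := by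
    intro x hx y hy hxy h
    simp only [hψ, Prod.mk.injEq] at h
    obtain ⟨t, ht, h1, h2⟩ := hsep x hx y hy hxy h.1
    refine (Finset.card_lt_card (s := T.filter (· < x)) (t := T.filter (· < y)) ?_).ne h.2
    rw [Finset.ssubset_iff_of_subset]
    · exact ⟨t, by simpa using ⟨ht, h2⟩, by simp [h1.le]⟩
    · intro u hu
      simp only [Finset.mem_filter] at hu ⊢
      exact ⟨hu.1, hu.2.trans hxy⟩
  have hinj : InjOn ψ S := by
    intro x hx y hy h
    rcases lt_trichotomy x y with h' | h' | h'
    · exact (key x hx y hy h' h).elim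
    · exact h'
    · exact (key y hy x hx h' h.symm).elim
  refine ⟨(Finset.finite_toSet _).of_injOn hmaps hinj, ?_⟩
  have := ncard_le_ncard_of_injOn ψ hmaps hinj (Finset.finite_toSet _)
  simpa [ncard_coe_finset] using this

namespace PiecewiseStrictMono

variable {g : ℝ → ℝ} {C : Finset ℝ}

theorem iterate_mem (hg : PiecewiseStrictMono g C) (n : ℕ) {x : ℝ}
    (hx : x ∈ Icc (-1 : ℝ) 1) : g^[n] x ∈ Icc (-1 : ℝ) 1 :=
  hg.mapsTo.iterate n hx

theorem continuousOn_iterate (hg : PiecewiseStrictMono g C) (n : ℕ) :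
    ContinuousOn g^[n] (Icc (-1) 1) :=
  hg.continuousOn.iterate hg.mapsTo n

/-- `g` is strictly monotone on the image of an interval under a strictly monotone map,
provided that the image of the interior avoids `C`. -/
theorem strict_uIcc (hg : PiecewiseStrictMono g C) {φ : ℝ → ℝ} {x y : ℝ} (hxy : x < y)
    (hc : ContinuousOn φ (Icc x y)) (hm : MapsTo φ (Icc x y) (Icc (-1) 1))
    (hφ : StrictMonoOn φ (Icc x y) ∨ StrictAntiOn φ (Icc x y))
    (hC : ∀ z ∈ Ioo x y, φ z ∉ C) :
    StrictMonoOn g (uIcc (φ x) (φ y)) ∨ StrictAntiOn g (uIcc (φ x) (φ y)) := by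
  have hx : x ∈ Icc x y := left_mem_Icc.2 hxy.le
  have hy : y ∈ Icc x y := right_mem_Icc.2 hxy.le
  rcases hφ with hφ | hφ
  · rw [uIcc_of_le (hφ hx hy hxy).le]
    refine hg.strict _ (hm hx) _ (hm hy) (hφ hx hy hxy) fun z hz hzC => ?_
    obtain ⟨w, hw, rfl⟩ := intermediate_value_Ioo hxy.le hc hz
    exact hC w hw hzC
  · rw [uIcc_of_ge (hφ hx hy hxy).le]
    refine hg.strict _ (hm hy) _ (hm hx) (hφ hx hy hxy) fun z hz hzC => ?_
    obtain ⟨w, hw, rfl⟩ := intermediate_value_Ioo' hxy.le hc hz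
    exact hC w hw hzC

theorem mapsTo_uIcc {φ : ℝ → ℝ} {x y : ℝ}
    (hφ : StrictMonoOn φ (Icc x y) ∨ StrictAntiOn φ (Icc x y)) :
    MapsTo φ (Icc x y) (uIcc (φ x) (φ y)) := by
  intro z hz
  have hx : x ∈ Icc x y := left_mem_Icc.2 (hz.1.trans hz.2)
  have hy : y ∈ Icc x y := right_mem_Icc.2 (hz.1.trans hz.2)
  rcases hφ with hφ | hφ
  · exact mem_uIcc_of_le (hφ.monotoneOn hx hz hz.1) (hφ.monotoneOn hz hy hz.2)
  · exact mem_uIcc_of_ge (hφ.antitoneOn hz hy hz.2) (hφ.antitoneOn hx hz hz.1)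

theorem iterate_strict (hg : PiecewiseStrictMono g C) (n : ℕ) {x y : ℝ}
    (hx : x ∈ Icc (-1 : ℝ) 1) (hy : y ∈ Icc (-1 : ℝ) 1) (hxy : x < y)
    (h : ∀ z ∈ Ioo x y, z ∉ hitSet g C n) :
    StrictMonoOn g^[n] (Icc x y) ∨ StrictAntiOn g^[n] (Icc x y) := by
  have hsub : Icc x y ⊆ Icc (-1) 1 := Icc_subset_Icc hx.1 hy.2
  induction n with
  | zero => exact Or.inl fun a _ b _ hab => hab
  | succ n ih =>
    have h1 := ih fun z hz hz' => h z hz (hitSet_mono g C n.le_succ hz')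
    have h2 := hg.strict_uIcc hxy ((hg.continuousOn_iterate n).mono hsub)
      (fun z hz => hg.iterate_mem n (hsub hz)) h1
      (fun z hz hz' => h z hz ⟨hsub (Ioo_subset_Icc_self hz), n, n.lt_succ_self, hz'⟩)
    have hm := mapsTo_uIcc h1
    rw [Function.iterate_succ']
    rcases h1 with h1 | h1 <;> rcases h2 with h2 | h2
    · exact Or.inl (h2.comp h1 hm)
    · exact Or.inr (h2.comp_strictMonoOn h1 hm)
    · exact Or.inr (h2.comp_strictAntiOn h1 hm)
    · exact Or.inl (h2.comp h1 hm)

theorem exists_hit_between (hg : PiecewiseStrictMono g C) (n : ℕ) {x y : ℝ}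
    (hx : x ∈ Icc (-1 : ℝ) 1) (hy : y ∈ Icc (-1 : ℝ) 1) (hxy : x < y)
    (h : g^[n] x = g^[n] y) : ∃ z ∈ hitSet g C n, x < z ∧ z < y := by
  by_contra! hcon
  have hx' : x ∈ Icc x y := left_mem_Icc.2 hxy.le
  have hy' : y ∈ Icc x y := right_mem_Icc.2 hxy.le
  rcases hg.iterate_strict n hx hy hxy (fun z hz hz' => (hcon z hz' hz.1).not_gt hz.2)
    with h1 | h1
  · exact (h1 hx' hy' hxy).ne h
  · exact (h1 hx' hy' hxy).ne' h

theorem hitSet_finite (hg : PiecewiseStrictMono g C) (n : ℕ) : (hitSet g C n).Finite := by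
  induction n with
  | zero => simp [hitSet]
  | succ n ih =>
    rw [hitSet_succ]
    refine ih.union (finite_ncard_le_of_separated (φ := g^[n]) ih C.finite_toSet
      (fun x hx => hx.2) fun x hx y hy hxy h => ?_).1
    exact hg.exists_hit_between n hx.1 hy.1 hxy h

theorem preimSet_finite_ncard (hg : PiecewiseStrictMono g C) (n : ℕ) (D : Finset ℝ) :
    (preimSet g n D).Finite ∧
      (preimSet g n D).ncard ≤ D.card * ((hitSet g C n).ncard + 1) := by
  have := finite_ncard_le_of_separated (S := preimSet g n D) (φ := g^[n]) (hg.hitSet_finite n)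
    D.finite_toSet (fun x hx => hx.2)
    fun x hx y hy hxy h => hg.exists_hit_between n hx.1 hy.1 hxy h
  rwa [ncard_coe_finset] at this

theorem hitSet_ncard_add_le (hg : PiecewiseStrictMono g C) (m n : ℕ) :
    (hitSet g C (m + n)).ncard + 1 ≤
      ((hitSet g C m).ncard + 1) * ((hitSet g C n).ncard + 1) := by
  have h1 := finite_ncard_le_of_separated (S := {x | x ∈ Icc (-1 : ℝ) 1 ∧ g^[m] x ∈ hitSet g C n})
    (φ := g^[m]) (hg.hitSet_finite m) (hg.hitSet_finite n) (fun x hx => hx.2)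
    fun x hx y hy hxy h => hg.exists_hit_between m hx.1 hy.1 hxy h
  have h2 : hitSet g C (m + n) ⊆
      hitSet g C m ∪ {x | x ∈ Icc (-1 : ℝ) 1 ∧ g^[m] x ∈ hitSet g C n} := by
    rintro x ⟨hx, k, hk, hkC⟩
    rcases lt_or_ge k m with hkm | hkm
    · exact Or.inl ⟨hx, k, hkm, hkC⟩
    · refine Or.inr ⟨hx, hg.iterate_mem m hx, k - m, by omega, ?_⟩
      rwa [← Function.iterate_add_apply, Nat.sub_add_cancel hkm]
  have h3 := (ncard_le_ncard h2 ((hg.hitSet_finite m).union h1.1)).trans (ncard_union_le _ _)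
  nlinarith [h1.2]

/-- `log (#hitSet n + 1)` is subadditive. -/
theorem subadditive_log (hg : PiecewiseStrictMono g C) :
    Subadditive fun n => Real.log ((hitSet g C n).ncard + 1) := by
  intro m n
  rw [← Real.log_mul (by positivity) (by positivity)]
  exact Real.log_le_log (by positivity) (by exact_mod_cast hg.hitSet_ncard_add_le m n)

/-- Orbits shadowed by a common orbit, with the same sequence of sides with respect to the
points hitting `C`, and with a common endpoint, coincide. -/
theorem preimSet_ncard_le_of_cover (hg : PiecewiseStrictMono g C) (N n : ℕ) (D : Finset ℝ)
    {δ : ℝ} (hδ : ∀ x ∈ hitSet g C N, ∀ y ∈ hitSet g C N, |x - y| < 2 * δ → x = y)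
    {S : Finset ℝ}
    (hS : Dynamics.IsDynCoverOf g (Icc (-1) 1) {p | dist p.1 p.2 < δ} (n * N) S)
    (hN : 0 < N) :
    (preimSet g (n * N) D).ncard ≤ D.card * S.card * 2 ^ n := by
  classical
  have hS' : ∀ x ∈ Icc (-1 : ℝ) 1, ∃ y ∈ S,
      (x, y) ∈ Dynamics.dynEntourage g {p | dist p.1 p.2 < δ} (n * N) := fun x hx => hS hx
  choose! w hwS hw using hS'
  have hw' : ∀ x ∈ Icc (-1 : ℝ) 1, ∀ k < n * N, |g^[k] x - g^[k] (w x)| < δ := fun x hx k hk =>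
    Dynamics.mem_dynEntourage.1 (hw x hx) k hk
  let side : ℝ → Fin n → Bool := fun x j =>
    decide (∃ e ∈ hitSet g C N, |e - g^[j * N] (w x)| < δ ∧ e < g^[j * N] x)
  let ψ : ℝ → (ℝ × ℝ) × (Fin n → Bool) := fun x => ((g^[n * N] x, w x), side x)
  have hmaps : MapsTo ψ (preimSet g (n * N) D)
      (((D ×ˢ S) ×ˢ (Finset.univ : Finset (Fin n → Bool)) : Finset _) : Set _) := by
    intro x hx
    simp only [Finset.coe_product, mem_prod, Finset.mem_coe, Finset.mem_univ, and_true, ψ]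
    exact ⟨hx.2, hwS x hx.1⟩
  have gap : ∀ u v a : ℝ, |u - a| < δ → |v - a| < δ →
      ((∃ e ∈ hitSet g C N, |e - a| < δ ∧ e < u) ↔ (∃ e ∈ hitSet g C N, |e - a| < δ ∧ e < v)) →
      u < v → ∀ z ∈ hitSet g C N, u < z → z < v → False := by
    intro u v a hu hv hiff huv z hz huz hzv
    rw [abs_lt] at hu hv
    have hza : |z - a| < δ := abs_lt.2 ⟨by linarith, by linarith⟩
    obtain ⟨e, he, hea, heu⟩ := hiff.2 ⟨z, hz, hza, hzv⟩
    rw [abs_lt] at hza hea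
    have := hδ e he z hz (abs_lt.2 ⟨by linarith, by linarith⟩)
    linarith
  have hinj : InjOn ψ (preimSet g (n * N) D) := by
    intro x hx y hy hxy
    simp only [ψ, Prod.mk.injEq] at hxy
    obtain ⟨⟨hend, hwxy⟩, hside⟩ := hxy
    have back : ∀ i ≤ n, g^[(n - i) * N] x = g^[(n - i) * N] y := by
      intro i
      induction i with
      | zero => intro _; simpa using hend
      | succ i ih =>
        intro hi
        have hprev := ih (by omega)
        obtain ⟨j, hj⟩ : ∃ j, j = n - (i + 1) := ⟨_, rfl⟩
        have hji : n - i = j + 1 := by omega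
        have hjn : j < n := by omega
        rw [← hj]
        rw [hji, Nat.add_mul, one_mul, Nat.add_comm, Function.iterate_add_apply,
          Function.iterate_add_apply] at hprev
        have hjN : j * N < n * N := Nat.mul_lt_mul_of_pos_right hjn hN
        have hux := hw' x hx.1 _ hjN
        have huy := hw' y hy.1 _ hjN
        rw [← hwxy] at huy
        have hiff := congrFun hside ⟨j, hjn⟩
        simp only [side, decide_eq_decide, ← hwxy] at hiff
        rcases lt_trichotomy (g^[j * N] x) (g^[j * N] y) with h | h | h
        · obtain ⟨z, hz, h1, h2⟩ := hg.exists_hit_between N (hg.iterate_mem _ hx.1)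
            (hg.iterate_mem _ hy.1) h hprev
          exact (gap _ _ _ hux huy hiff h z hz h1 h2).elim
        · exact h
        · obtain ⟨z, hz, h1, h2⟩ := hg.exists_hit_between N (hg.iterate_mem _ hy.1)
            (hg.iterate_mem _ hx.1) h hprev.symm
          exact (gap _ _ _ huy hux hiff.symm h z hz h1 h2).elim
    simpa using back n le_rfl
  have := ncard_le_ncard_of_injOn ψ hmaps hinj (Finset.finite_toSet _)
  rwa [ncard_coe_finset, Finset.card_product, Finset.card_product, Finset.card_univ,
    Fintype.card_fun, Fintype.card_bool, Fintype.card_fin] at this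

end PiecewiseStrictMono

theorem exists_finset_separating (ε : ℝ) (hε : 0 < ε) :
    ∃ Z : Finset ℝ, (-1 : ℝ) ∈ Z ∧
      ∀ x ∈ Icc (-1 : ℝ) 1, ∀ y ∈ Icc (-1 : ℝ) 1, x + ε ≤ y → ∃ z ∈ Z, x < z ∧ z < y := by
  classical
  refine ⟨(Finset.range (⌊2 / (ε / 2)⌋₊ + 2)).image fun i : ℕ => -1 + i * (ε / 2), ?_, ?_⟩
  · exact Finset.mem_image.2 ⟨0, by simp, by simp⟩
  · intro x hx y hy hxy
    refine ⟨_, Finset.mem_image.2 ⟨⌊(x + 1) / (ε / 2)⌋₊ + 1, ?_, rfl⟩, ?_, ?_⟩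
    · have : ⌊(x + 1) / (ε / 2)⌋₊ ≤ ⌊2 / (ε / 2)⌋₊ := by
        apply Nat.floor_le_floor
        gcongr
        linarith [hx.2]
      simpa using this
    · have := Nat.lt_floor_add_one ((x + 1) / (ε / 2))
      rw [div_lt_iff₀ (by positivity)] at this
      push_cast
      linarith
    · have h0 : 0 ≤ (x + 1) / (ε / 2) := div_nonneg (by linarith [hx.1]) (by positivity)
      have := Nat.floor_le h0
      rw [le_div_iff₀ (by positivity)] at this
      push_cast
      linarith

theorem exists_pos_forall_abs_sub_lt {S : Set ℝ} (hS : S.Finite) :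
    ∃ δ > 0, ∀ x ∈ S, ∀ y ∈ S, |x - y| < 2 * δ → x = y := by
  classical
  have hfin : ((fun p : ℝ × ℝ => |p.1 - p.2|) '' S.offDiag).Finite := (hS.offDiag).image _
  have h0 : ∀ᶠ δ in 𝓝[>] (0 : ℝ), ∀ r ∈ (fun p : ℝ × ℝ => |p.1 - p.2|) '' S.offDiag,
      2 * δ < r := by
    rw [hfin.eventually_all]
    rintro _ ⟨p, hp, rfl⟩
    have hpos : 0 < |p.1 - p.2| / 2 := half_pos (abs_pos.2 (sub_ne_zero.2 hp.2.2))
    filter_upwards [Ioo_mem_nhdsGT hpos] with δ hδ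
    have := hδ.2
    linarith
  obtain ⟨δ, h, hδ⟩ := (h0.and self_mem_nhdsWithin).exists
  refine ⟨δ, hδ, fun x hx y hy hxy => ?_⟩
  by_contra hne
  exact hxy.not_gt (h _ ⟨(x, y), ⟨hx, hy, hne⟩, rfl⟩)

namespace PiecewiseStrictMono

variable {g : ℝ → ℝ} {C : Finset ℝ}

theorem preimSet_ncard_mul_pow_summable (hg : PiecewiseStrictMono g C) {s t : ℝ} (hs : 0 < s)
    (hent : Dynamics.coverEntropy g (Icc (-1) 1) ≤ (Real.log s : EReal)) (ht : 0 < t)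
    (hts : t * s < 1) : Summable fun n => ((preimSet g n C).ncard : ℝ) * t ^ n := by
  obtain ⟨u, hsu, htu⟩ : ∃ u, s < u ∧ t * u < 1 := by
    obtain ⟨u, h1, h2⟩ := exists_between ((lt_div_iff₀' ht).2 hts)
    exact ⟨u, h1, (lt_div_iff₀' ht).1 h2⟩
  have hu : 0 < u := hs.trans hsu
  obtain ⟨N, hN⟩ := exists_pow_lt_of_lt_one (y := t * u) (show (0 : ℝ) < 1 / 2 by norm_num) htu
  have hN0 : 0 < N := Nat.pos_of_ne_zero (by rintro rfl; norm_num at hN)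
  set κ : ℝ := 2 ^ (1 / N : ℝ) with hκ
  have hκ1 : 1 ≤ κ := Real.one_le_rpow (by norm_num) (by positivity)
  have hκN : κ ^ N = 2 := by
    rw [hκ, ← Real.rpow_natCast, ← Real.rpow_mul (by norm_num), one_div,
      inv_mul_cancel₀ (by positivity), Real.rpow_one]
  have hκtu : κ * (t * u) < 1 := by
    rw [← pow_lt_one_iff_of_nonneg (by positivity) hN0.ne', mul_pow, hκN]
    linarith
  have hfloor : ∀ m : ℕ, (2 : ℝ) ^ (m / N) ≤ κ ^ m := fun m => by
    rw [← hκN, ← pow_mul]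
    exact pow_le_pow_right₀ hκ1 (Nat.mul_div_le m N)
  obtain ⟨δ, hδ, hsep⟩ := exists_pos_forall_abs_sub_lt (hg.hitSet_finite N)
  set U : SetRel ℝ ℝ := {p | dist p.1 p.2 < δ} with hU
  have hUmem : U ∈ uniformity ℝ := Metric.dist_mem_uniformity hδ
  have hgrow : Dynamics.coverEntropyEntourage g (Icc (-1) 1) U < (Real.log u : EReal) :=
    ((Dynamics.coverEntropyEntourage_le_coverEntropy g _ hUmem).trans hent).trans_lt
      (by exact_mod_cast Real.log_lt_log hs hsu)
  have hev := ExpGrowth.eventually_le_exp hgrow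
  set D : Finset ℝ := (hg.hitSet_finite N).toFinset with hD
  refine Summable.of_norm_bounded_eventually_nat (g := fun m => D.card * (κ * (t * u)) ^ m)
    ((summable_geometric_of_lt_one (by positivity) hκtu).mul_left _) ?_
  filter_upwards [hev] with m hm
  obtain ⟨S, hS, hScard⟩ := (Dynamics.coverMincard_finite_iff g (Icc (-1) 1) U m).1
    (Dynamics.coverMincard_finite_of_isCompact_invariant isCompact_Icc hg.mapsTo hUmem m)
  rw [← hScard] at hm
  have hSu : (S.card : ℝ) ≤ u ^ m := by
    have h1 : (((Real.log u : ℝ) : EReal) * (m : EReal)) = ((Real.log u * m : ℝ) : EReal) := by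
      push_cast; rfl
    rw [h1, EReal.exp_coe, mul_comm, Real.exp_nat_mul, Real.exp_log hu] at hm
    rwa [ENat.toENNReal_coe, ← ENNReal.ofReal_natCast,
      ENNReal.ofReal_le_ofReal_iff (by positivity)] at hm
  have hsub : preimSet g m C ⊆ preimSet g (m / N * N) D := by
    rintro x ⟨hx, hxC⟩
    refine ⟨hx, ?_⟩
    rw [hD, Set.Finite.mem_toFinset]
    refine ⟨hg.iterate_mem _ hx, m % N, Nat.mod_lt _ hN0, ?_⟩
    rwa [← Function.iterate_add_apply, Nat.mod_add_div']
  have hcount := (ncard_le_ncard hsub (hg.preimSet_finite_ncard _ D).1).trans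
    (hg.preimSet_ncard_le_of_cover N (m / N) D hsep (hS.of_le (Nat.div_mul_le_self m N)) hN0)
  have hcount' : ((preimSet g m C).ncard : ℝ) ≤ D.card * S.card * 2 ^ (m / N) := by
    exact_mod_cast hcount
  rw [Real.norm_of_nonneg (by positivity)]
  calc ((preimSet g m C).ncard : ℝ) * t ^ m
      ≤ (D.card * u ^ m * κ ^ m) * t ^ m := by
        gcongr
        exact hcount'.trans (by gcongr; exact hfloor m)
    _ = D.card * (κ * (t * u)) ^ m := by rw [mul_pow, mul_pow]; ring

theorem pow_le_hitSet_ncard (hg : PiecewiseStrictMono g C) {s : ℝ}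
    (hent : (Real.log s : EReal) ≤ Dynamics.coverEntropy g (Icc (-1) 1)) {n : ℕ} (hn : n ≠ 0) :
    s ^ n ≤ (hitSet g C n).ncard + 1 := by
  by_contra! hlt
  have hpos : ∀ m, (0 : ℝ) < (hitSet g C m).ncard + 1 := fun m => by positivity
  have hn' : (0 : ℝ) < n := by positivity
  have h1 : Real.log ((hitSet g C n).ncard + 1) / n < Real.log s := by
    rw [div_lt_iff₀ hn', mul_comm, ← Real.log_pow]
    exact Real.log_lt_log (hpos n) hlt
  obtain ⟨L, hL1, hL⟩ := exists_between h1
  obtain ⟨L', hLL', hL's⟩ := exists_between hL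
  have hev := hg.subadditive_log.eventually_div_lt_of_div_lt hn hL1
  refine absurd hent (not_le.2 (lt_of_le_of_lt ?_ (EReal.coe_lt_coe_iff.2 hL's)))
  rw [Dynamics.coverEntropy_eq_iSup_basis Metric.uniformity_basis_dist]
  refine iSup₂_le fun ε hε => ?_
  obtain ⟨Z, hZ1, hZ⟩ := exists_finset_separating ε hε
  refine Eventually.expGrowthSup_le ?_
  have hlim : ∀ᶠ m : ℕ in atTop, (m : ℝ) * Z.card * Real.exp (L * m) ≤ Real.exp (L' * m) := by
    have h2 : Tendsto (fun m : ℕ => (m : ℝ) * Z.card * Real.exp (L - L') ^ m) atTop (𝓝 0) := by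
      have := (tendsto_self_mul_const_pow_of_lt_one (r := Real.exp (L - L'))
        (Real.exp_pos _).le (Real.exp_lt_one_iff.2 (by linarith))).mul_const (Z.card : ℝ)
      rw [zero_mul] at this
      refine this.congr fun m => by ring
    filter_upwards [h2.eventually (gt_mem_nhds one_pos)] with m hm
    have h3 : Real.exp (L * m) = Real.exp (L - L') ^ m * Real.exp (L' * m) := by
      rw [← Real.exp_nat_mul, ← Real.exp_add]; ring_nf
    rw [h3, ← mul_assoc]
    exact mul_le_of_le_one_left (Real.exp_pos _).le hm.le
  filter_upwards [hev, hlim, eventually_gt_atTop 0] with m hm hlm hm0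
  have hS : (hitSet g Z m) = ⋃ k : Fin m, preimSet g k Z := by
    ext x
    simp only [hitSet, preimSet, mem_iUnion, mem_ofPred_eq]
    constructor
    · rintro ⟨hx, k, hk, h⟩
      exact ⟨⟨k, hk⟩, hx, h⟩
    · rintro ⟨k, hx, h⟩
      exact ⟨hx, k, k.2, h⟩
  have hfin : (hitSet g Z m).Finite := by
    rw [hS]
    exact finite_iUnion fun k => (hg.preimSet_finite_ncard k Z).1
  have hcard : (hitSet g Z m).ncard ≤ m * (Z.card * ((hitSet g C m).ncard + 1)) := by
    rw [hS]
    refine (ncard_iUnion_le_of_fintype _).trans ?_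
    have hk : ∀ k ∈ (Finset.univ : Finset (Fin m)),
        (preimSet g k Z).ncard ≤ Z.card * ((hitSet g C m).ncard + 1) := fun k _ => by
      refine (hg.preimSet_finite_ncard k Z).2.trans ?_
      gcongr
      exacts [hg.hitSet_finite m, hitSet_mono g C k.2.le]
    simpa using Finset.sum_le_card_nsmul _ _ _ hk
  have hcover : Dynamics.IsDynCoverOf g (Icc (-1) 1) {p | dist p.1 p.2 < ε} m hfin.toFinset := by
    intro x hx
    obtain ⟨w, ⟨hwS, hwx⟩, hwmax⟩ := (hfin.inter_of_left (Iic x)).exists_maximal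
      ⟨-1, ⟨⟨by norm_num, by norm_num⟩, 0, hm0, by simpa using hZ1⟩, hx.1⟩
    refine ⟨w, by simpa using hwS, ?_⟩
    rw [Dynamics.mem_dynEntourage]
    intro k hk
    have hw := hwS.1
    have hsub : Icc w x ⊆ Icc (-1) 1 := Icc_subset_Icc hw.1 hx.2
    have hnot : ∀ z ∈ Ioo w x, g^[k] z ∉ Z := fun z hz hzZ =>
      hz.1.not_ge (hwmax ⟨⟨hsub (Ioo_subset_Icc_self hz), k, hk, hzZ⟩, hz.2.le⟩ hz.1.le)
    have hcont := (hg.continuousOn_iterate k).mono hsub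
    have hkx := hg.iterate_mem k hx
    have hkw := hg.iterate_mem k hw
    change |g^[k] x - g^[k] w| < ε
    by_contra! hge
    rcases le_abs.1 hge with h | h
    · obtain ⟨z, hz, h1, h2⟩ := hZ _ hkw _ hkx (by linarith)
      obtain ⟨y, hy, rfl⟩ := intermediate_value_Ioo hwx hcont ⟨h1, h2⟩
      exact hnot y hy hz
    · obtain ⟨z, hz, h1, h2⟩ := hZ _ hkx _ hkw (by linarith)
      obtain ⟨y, hy, rfl⟩ := intermediate_value_Ioo' hwx hcont ⟨h1, h2⟩
      exact hnot y hy hz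
  have h4 : (((L' : ℝ) : EReal) * (m : EReal)) = ((L' * m : ℝ) : EReal) := by push_cast; rfl
  rw [h4, EReal.exp_coe]
  have h5 : ((Dynamics.coverMincard g (Icc (-1) 1) {p | dist p.1 p.2 < ε} m : ℕ∞) : ENNReal) ≤
      ((hfin.toFinset.card : ℕ∞) : ENNReal) := by
    exact_mod_cast hcover.coverMincard_le_card
  refine h5.trans ?_
  rw [ENat.toENNReal_coe, ← ENNReal.ofReal_natCast]
  apply ENNReal.ofReal_le_ofReal
  rw [← ncard_eq_toFinset_card _ hfin]
  rw [div_lt_iff₀ (by positivity), Real.log_lt_iff_lt_exp (hpos m)] at hm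
  calc ((hitSet g Z m).ncard : ℝ) ≤ m * (Z.card * ((hitSet g C m).ncard + 1)) := by
        exact_mod_cast hcard
    _ ≤ m * (Z.card * Real.exp (L * m)) := by gcongr
    _ ≤ _ := by rw [← mul_assoc]; exact hlm

end PiecewiseStrictMono

/-- If the partial sums of `p` grow at least like `s ^ n`, then the power series with
coefficients `p` tends to infinity at `s⁻¹`. -/
theorem tendsto_tsum_mul_pow_atTop {p : ℕ → ℝ} (hp : ∀ n, 0 ≤ p n) {s : ℝ} (hs : 1 < s)
    (hgrow : ∀ n, s ^ n ≤ (∑ k ∈ Finset.range n, p k) + 1)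
    (hsum : ∀ t, 0 < t → t < s⁻¹ → Summable fun n => p n * t ^ n) :
    Tendsto (fun t => ∑' n, p n * t ^ n) (𝓝[<] s⁻¹) atTop := by
  have hs0 : 0 < s := one_pos.trans hs
  have hnot : ¬ Summable fun n => p n * s⁻¹ ^ n := by
    intro hS
    obtain ⟨K, hK⟩ := ((tendsto_sum_nat_add fun n => p n * s⁻¹ ^ n).eventually
      (gt_mem_nhds (show (0 : ℝ) < 1 / 2 by norm_num))).exists
    have hbound : ∀ m, s ^ (m + K) ≤ 2 * ((∑ k ∈ Finset.range K, p k) + 1) := by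
      intro m
      have h1 : ∑ k ∈ Finset.range m, p (k + K) * s⁻¹ ^ (k + K) ≤ 1 / 2 :=
        (((summable_nat_add_iff K).2 hS).sum_le_tsum _
          fun i _ => mul_nonneg (hp _) (by positivity)).trans hK.le
      have h2 : ∑ k ∈ Finset.range m, p (k + K) ≤
          s ^ (m + K) * ∑ k ∈ Finset.range m, p (k + K) * s⁻¹ ^ (k + K) := by
        rw [Finset.mul_sum]
        refine Finset.sum_le_sum fun k hk => ?_
        have h3 : s ^ (k + K) ≤ s ^ (m + K) :=
          pow_le_pow_right₀ hs.le (by simp at hk; omega)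
        have h4 : s ^ (k + K) * s⁻¹ ^ (k + K) = 1 := by
          rw [← mul_pow, mul_inv_cancel₀ hs0.ne', one_pow]
        calc p (k + K) = s ^ (k + K) * (p (k + K) * s⁻¹ ^ (k + K)) := by
              rw [mul_left_comm, h4, mul_one]
          _ ≤ _ := mul_le_mul_of_nonneg_right h3 (mul_nonneg (hp _) (by positivity))
      have h5 := hgrow (m + K)
      rw [add_comm m K, Finset.sum_range_add, add_comm K m] at h5
      simp only [add_comm K] at h5
      have h6 := mul_le_mul_of_nonneg_left h1 (show 0 ≤ s ^ (m + K) by positivity)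
      linarith
    obtain ⟨m, hm⟩ := pow_unbounded_of_one_lt (2 * ((∑ k ∈ Finset.range K, p k) + 1)) hs
    exact ((hbound m).trans_lt hm).not_ge (pow_le_pow_right₀ hs.le (by omega))
  rw [not_summable_iff_tendsto_nat_atTop_of_nonneg
    fun n => mul_nonneg (hp n) (by positivity)] at hnot
  rw [tendsto_atTop]
  intro B
  obtain ⟨M, hM⟩ := (hnot.eventually (eventually_gt_atTop B)).exists
  have hcont : Tendsto (fun t => ∑ k ∈ Finset.range M, p k * t ^ k) (𝓝[<] s⁻¹)
      (𝓝 (∑ k ∈ Finset.range M, p k * s⁻¹ ^ k)) :=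
    ((by fun_prop : Continuous fun t : ℝ => ∑ k ∈ Finset.range M, p k * t ^ k).tendsto
      _).mono_left nhdsWithin_le_nhds
  filter_upwards [hcont.eventually (lt_mem_nhds hM),
    Ioo_mem_nhdsLT (inv_pos.2 hs0)] with t ht htI
  exact ht.le.trans ((hsum t htI.1 htI.2).sum_le_tsum _
    fun i _ => mul_nonneg (hp _) (pow_nonneg htI.1.le _))

/-- The number of points of `[-1,x]` sent into `C` by the `n`-th iterate. -/
noncomputable def preimCount (g : ℝ → ℝ) (C : Finset ℝ) (n : ℕ) (x : ℝ) : ℝ :=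
  ((preimSet g n C ∩ Iic x).ncard : ℝ)

theorem preimCount_nonneg (g : ℝ → ℝ) (C : Finset ℝ) (n : ℕ) (x : ℝ) :
    0 ≤ preimCount g C n x := Nat.cast_nonneg _

namespace PiecewiseStrictMono

variable {g : ℝ → ℝ} {C : Finset ℝ}

theorem preimCount_mono (hg : PiecewiseStrictMono g C) (n : ℕ) : Monotone (preimCount g C n) := by
  intro x y hxy
  exact Nat.cast_le.2 (ncard_le_ncard (inter_subset_inter_right _ (Iic_subset_Iic.2 hxy))
    ((hg.preimSet_finite_ncard n C).1.inter_of_left _))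

theorem preimCount_sub (hg : PiecewiseStrictMono g C) (n : ℕ) {x y : ℝ} (hxy : x ≤ y) :
    preimCount g C n y - preimCount g C n x = ((preimSet g n C ∩ Ioc x y).ncard : ℝ) := by
  have hfin := (hg.preimSet_finite_ncard n C).1
  rw [sub_eq_iff_eq_add', preimCount, preimCount, ← Iic_union_Ioc_eq_Iic hxy,
    inter_union_distrib_left, ncard_union_eq _ (hfin.inter_of_left _) (hfin.inter_of_left _)]
  · push_cast; rfl
  · exact (Iic_disjoint_Ioc le_rfl).mono inter_subset_right inter_subset_right

theorem preimCount_one (n : ℕ) : preimCount g C n 1 = ((preimSet g n C).ncard : ℝ) := by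
  rw [preimCount, inter_eq_left.2 fun x hx => hx.1.2]

theorem preimCount_le (hg : PiecewiseStrictMono g C) (n : ℕ) (x : ℝ) :
    preimCount g C n x ≤ preimCount g C n 1 := by
  rw [preimCount_one]
  exact Nat.cast_le.2 (ncard_le_ncard inter_subset_left (hg.preimSet_finite_ncard n C).1)

theorem preimCount_neg_one_le (n : ℕ) : preimCount g C n (-1) ≤ 1 := by
  have : preimSet g n C ∩ Iic (-1) ⊆ {-1} := fun x hx => le_antisymm hx.2 hx.1.1.1
  have := ncard_le_ncard this (finite_singleton _)
  rw [ncard_singleton] at this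
  exact Nat.cast_le_one.2 this

theorem preimCount_succ_sub_of_mono (hg : PiecewiseStrictMono g C) (n : ℕ) {x y : ℝ}
    (hx : x ∈ Icc (-1 : ℝ) 1) (hy : y ∈ Icc (-1 : ℝ) 1) (hxy : x ≤ y)
    (h : StrictMonoOn g (Icc x y)) :
    preimCount g C (n + 1) y - preimCount g C (n + 1) x =
      preimCount g C n (g y) - preimCount g C n (g x) := by
  have hsub : Icc x y ⊆ Icc (-1) 1 := Icc_subset_Icc hx.1 hy.2
  have hx' := left_mem_Icc.2 hxy
  have hy' := right_mem_Icc.2 hxy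
  rw [hg.preimCount_sub _ hxy, hg.preimCount_sub _ (h.monotoneOn hx' hy' hxy),
    ← (h.injOn.mono fun z hz => Ioc_subset_Icc_self hz.2).ncard_image]
  congr 2
  ext w
  constructor
  · rintro ⟨z, ⟨hz, hzI⟩, rfl⟩
    have hz' := Ioc_subset_Icc_self hzI
    exact ⟨⟨hg.mapsTo (hsub hz'), hz.2⟩, h hx' hz' hzI.1, h.monotoneOn hz' hy' hzI.2⟩
  · rintro ⟨hw, hwI⟩
    obtain ⟨z, hz, rfl⟩ := intermediate_value_Ioc hxy (hg.continuousOn.mono hsub) hwI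
    exact ⟨z, ⟨⟨hsub (Ioc_subset_Icc_self hz), hw.2⟩, hz⟩, rfl⟩

theorem preimCount_succ_sub_of_anti (hg : PiecewiseStrictMono g C) (n : ℕ) {x y : ℝ}
    (hx : x ∈ Icc (-1 : ℝ) 1) (hy : y ∈ Icc (-1 : ℝ) 1) (hxy : x ≤ y)
    (h : StrictAntiOn g (Icc x y)) :
    |(preimCount g C (n + 1) y - preimCount g C (n + 1) x) -
      (preimCount g C n (g x) - preimCount g C n (g y))| ≤ 1 := by
  have hsub : Icc x y ⊆ Icc (-1) 1 := Icc_subset_Icc hx.1 hy.2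
  have hx' := left_mem_Icc.2 hxy
  have hy' := right_mem_Icc.2 hxy
  have himage : g '' (preimSet g (n + 1) C ∩ Ioc x y) = preimSet g n C ∩ Ico (g y) (g x) := by
    ext w
    constructor
    · rintro ⟨z, ⟨hz, hzI⟩, rfl⟩
      have hz' := Ioc_subset_Icc_self hzI
      exact ⟨⟨hg.mapsTo (hsub hz'), hz.2⟩, h.antitoneOn hz' hy' hzI.2, h hx' hz' hzI.1⟩
    · rintro ⟨hw, hwI⟩
      obtain ⟨z, hz, rfl⟩ := intermediate_value_Ioc' hxy (hg.continuousOn.mono hsub) hwI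
      exact ⟨z, ⟨⟨hsub (Ioc_subset_Icc_self hz), hw.2⟩, hz⟩, rfl⟩
  rw [hg.preimCount_sub _ hxy, hg.preimCount_sub _ (h.antitoneOn hx' hy' hxy),
    ← (h.injOn.mono fun z hz => Ioc_subset_Icc_self hz.2).ncard_image, himage]
  have hfin := (hg.preimSet_finite_ncard n C).1
  have h1 : preimSet g n C ∩ Ico (g y) (g x) ⊆
      insert (g y) (preimSet g n C ∩ Ioc (g y) (g x)) := by
    rintro z ⟨hz, hz1, hz2⟩
    rcases hz1.eq_or_lt with h | h
    · exact Or.inl h.symm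
    · exact Or.inr ⟨hz, h, hz2.le⟩
  have h2 : preimSet g n C ∩ Ioc (g y) (g x) ⊆
      insert (g x) (preimSet g n C ∩ Ico (g y) (g x)) := by
    rintro z ⟨hz, hz1, hz2⟩
    rcases hz2.eq_or_lt with h | h
    · exact Or.inl h
    · exact Or.inr ⟨hz, hz1.le, h⟩
  have h3 := (ncard_le_ncard h1 ((hfin.inter_of_left _).insert _)).trans (ncard_insert_le _ _)
  have h4 := (ncard_le_ncard h2 ((hfin.inter_of_left _).insert _)).trans (ncard_insert_le _ _)
  have h3' : ((preimSet g n C ∩ Ico (g y) (g x)).ncard : ℝ) ≤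
    (preimSet g n C ∩ Ioc (g y) (g x)).ncard + 1 := by exact_mod_cast h3
  have h4' : ((preimSet g n C ∩ Ioc (g y) (g x)).ncard : ℝ) ≤
    (preimSet g n C ∩ Ico (g y) (g x)).ncard + 1 := by exact_mod_cast h4
  rw [abs_le]
  constructor <;> linarith

end PiecewiseStrictMono

theorem abs_tsum_sub_mul_tsum_le {a b : ℕ → ℝ} {t : ℝ} (ht : 0 < t) (ht1 : t < 1)
    (ha : Summable fun n => a n * t ^ n) (hb : Summable fun n => b n * t ^ n)
    (hab : ∀ n, |a (n + 1) - b n| ≤ 1) :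
    |∑' n, a n * t ^ n - t * ∑' n, b n * t ^ n| ≤ |a 0| + (1 - t)⁻¹ := by
  have hgeo := summable_geometric_of_lt_one ht.le ht1
  have hle : ∀ n, ‖a (n + 1) * t ^ (n + 1) - t * (b n * t ^ n)‖ ≤ t ^ n := fun n => by
    have h1 : a (n + 1) * t ^ (n + 1) - t * (b n * t ^ n) =
        (a (n + 1) - b n) * (t * t ^ n) := by ring
    rw [h1, norm_mul, Real.norm_eq_abs, Real.norm_of_nonneg (by positivity)]
    calc |a (n + 1) - b n| * (t * t ^ n) ≤ 1 * (1 * t ^ n) := by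
          gcongr
          exact hab n
      _ = t ^ n := by ring
  have h2 : ∑' n, a n * t ^ n - t * ∑' n, b n * t ^ n =
      a 0 + ∑' n, (a (n + 1) * t ^ (n + 1) - t * (b n * t ^ n)) := by
    rw [ha.tsum_eq_zero_add, ((summable_nat_add_iff 1).2 ha).tsum_sub (hb.mul_left t),
      tsum_mul_left]
    ring
  rw [h2, ← tsum_geometric_of_lt_one ht.le ht1]
  exact (abs_add_le _ _).trans (add_le_add le_rfl
    (tsum_of_norm_bounded hgeo.hasSum hle))

namespace PiecewiseStrictMono

variable {g : ℝ → ℝ} {C : Finset ℝ}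

theorem ncard_hitSet_le (g : ℝ → ℝ) (C : Finset ℝ) (n : ℕ) :
    (hitSet g C n).ncard ≤ ∑ k ∈ Finset.range n, (preimSet g k C).ncard := by
  induction n with
  | zero => simp [hitSet]
  | succ n ih =>
    rw [hitSet_succ, Finset.sum_range_succ]
    exact (ncard_union_le _ _).trans (by gcongr)

/-- The limit of the normalised preimage counts is a monotone function expanded by the
factor `s` on every interval of monotonicity. -/
theorem exists_monotone_scaling (hg : PiecewiseStrictMono g C) {s : ℝ} (hs : 1 < s)
    (hent : Dynamics.coverEntropy g (Icc (-1) 1) = (Real.log s : EReal)) :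
    ∃ h : ℝ → ℝ, Monotone h ∧ h (-1) = 0 ∧ h 1 = 1 ∧
      (∀ x ∈ Icc (-1 : ℝ) 1, ∀ y ∈ Icc (-1 : ℝ) 1, x ≤ y → StrictMonoOn g (Icc x y) →
        h (g y) - h (g x) = s * (h y - h x)) ∧
      (∀ x ∈ Icc (-1 : ℝ) 1, ∀ y ∈ Icc (-1 : ℝ) 1, x ≤ y → StrictAntiOn g (Icc x y) →
        h (g x) - h (g y) = s * (h y - h x)) := by
  have hs0 : 0 < s := one_pos.trans hs
  have hsumm : ∀ t, 0 < t → t < s⁻¹ → ∀ x, Summable fun n => preimCount g C n x * t ^ n := by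
    intro t ht hts x
    have h1 := hg.preimSet_ncard_mul_pow_summable hs0 hent.le ht
      (by rwa [← lt_div_iff₀ hs0, one_div])
    refine Summable.of_nonneg_of_le
      (fun n => mul_nonneg (preimCount_nonneg g C n x) (by positivity)) (fun n => ?_) h1
    gcongr
    exact (hg.preimCount_le n x).trans_eq (preimCount_one n)
  set P : ℝ → ℝ → ℝ := fun t x => ∑' n, preimCount g C n x * t ^ n with hP
  have hPtop : Tendsto (fun t => P t 1) (𝓝[<] s⁻¹) atTop := by
    refine tendsto_tsum_mul_pow_atTop (fun n => preimCount_nonneg g C n 1) hs (fun n => ?_)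
      fun t ht hts => hsumm t ht hts 1
    rcases eq_or_ne n 0 with rfl | hn
    · simp
    · refine (hg.pow_le_hitSet_ncard hent.ge hn).trans ?_
      simp only [preimCount_one]
      have := ncard_hitSet_le g C n
      gcongr
      exact_mod_cast this
  have hPmono : ∀ t, 0 < t → t < s⁻¹ → Monotone (P t) := by
    intro t ht hts x y hxy
    refine (hsumm t ht hts x).tsum_le_tsum (fun n => ?_) (hsumm t ht hts y)
    gcongr
    exact hg.preimCount_mono n hxy
  have hPle : ∀ t, 0 < t → t < s⁻¹ → ∀ x, P t x ≤ P t 1 := by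
    intro t ht hts x
    refine (hsumm t ht hts x).tsum_le_tsum (fun n => ?_) (hsumm t ht hts 1)
    gcongr
    exact hg.preimCount_le n x
  have hPnn : ∀ t, 0 < t → ∀ x, 0 ≤ P t x := fun t ht x =>
    tsum_nonneg fun n => mul_nonneg (preimCount_nonneg g C n x) (by positivity)
  have hs1 : s⁻¹ < 1 := inv_lt_one_of_one_lt₀ hs
  let 𝓤 : Ultrafilter ℝ := Ultrafilter.of (𝓝[<] s⁻¹)
  have h𝓤 : (𝓤 : Filter ℝ) ≤ 𝓝[<] s⁻¹ := Ultrafilter.of_le _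
  have hI : ∀ᶠ t in (𝓤 : Filter ℝ), 0 < t ∧ t < s⁻¹ ∧ 0 < P t 1 := by
    filter_upwards [h𝓤 (Ioo_mem_nhdsLT (inv_pos.2 hs0)),
      h𝓤 (hPtop.eventually (eventually_gt_atTop 0))] with t h1 h2
    exact ⟨h1.1, h1.2, h2⟩
  have hlim : ∀ x, ∃ l, Tendsto (fun t => P t x / P t 1) 𝓤 (𝓝 l) := by
    intro x
    obtain ⟨l, -, hl⟩ := (isCompact_Icc (a := (0 : ℝ)) (b := 1)).ultrafilter_le_nhds
      (𝓤.map fun t => P t x / P t 1) (by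
        rw [le_principal_iff, Ultrafilter.coe_map, mem_map]
        filter_upwards [hI] with t ht
        exact ⟨div_nonneg (hPnn t ht.1 x) ht.2.2.le,
          (div_le_one ht.2.2).2 (hPle t ht.1 ht.2.1 x)⟩)
    exact ⟨l, hl⟩
  choose h hh using hlim
  have hinv : ∀ K : ℝ, Tendsto (fun t => K / P t 1) 𝓤 (𝓝 0) := fun K =>
    (hPtop.mono_left h𝓤).const_div_atTop K
  have ht𝓤 : Tendsto (fun t => t) (𝓤 : Filter ℝ) (𝓝 s⁻¹) := h𝓤.trans nhdsWithin_le_nhds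
  have hbound : ∀ t, 0 < t → t < s⁻¹ → (1 - t)⁻¹ ≤ (1 - s⁻¹)⁻¹ := fun t _ hts =>
    inv_anti₀ (by linarith) (by linarith)
  have hscale : ∀ x y x' y' : ℝ,
      (∀ n, |(preimCount g C (n + 1) y - preimCount g C (n + 1) x) -
        (preimCount g C n y' - preimCount g C n x')| ≤ 1) →
      h y' - h x' = s * (h y - h x) := by
    intro x y x' y' hn
    set K : ℝ := |preimCount g C 0 y - preimCount g C 0 x| + (1 - s⁻¹)⁻¹
    have h1 : Tendsto (fun t => (P t y / P t 1 - P t x / P t 1) -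
        t * (P t y' / P t 1 - P t x' / P t 1)) 𝓤 (𝓝 0) := by
      refine squeeze_zero_norm' ?_ (hinv K)
      filter_upwards [hI] with t ⟨ht, hts, hPt⟩
      have h2 := abs_tsum_sub_mul_tsum_le ht (hts.trans hs1)
        (a := fun n => preimCount g C n y - preimCount g C n x)
        (b := fun n => preimCount g C n y' - preimCount g C n x')
        (((hsumm t ht hts y).sub (hsumm t ht hts x)).congr fun n => by ring)
        (((hsumm t ht hts y').sub (hsumm t ht hts x')).congr fun n => by ring) hn
      simp only [sub_mul] at h2
      rw [(hsumm t ht hts y).tsum_sub (hsumm t ht hts x),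
        (hsumm t ht hts y').tsum_sub (hsumm t ht hts x')] at h2
      have h3 : (P t y / P t 1 - P t x / P t 1) - t * (P t y' / P t 1 - P t x' / P t 1) =
          ((P t y - P t x) - t * (P t y' - P t x')) / P t 1 := by ring
      rw [h3, norm_div, Real.norm_of_nonneg hPt.le]
      gcongr
      exact h2.trans (add_le_add le_rfl (hbound t ht hts))
    have h4 := tendsto_nhds_unique h1
      (((hh y).sub (hh x)).sub (ht𝓤.mul ((hh y').sub (hh x'))))
    field_simp at h4
    linarith
  refine ⟨h, fun x y hxy => ?_, ?_, ?_, fun x hx y hy hxy hm => ?_, fun x hx y hy hxy hm => ?_⟩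
  · refine le_of_tendsto_of_tendsto (hh x) (hh y) ?_
    filter_upwards [hI] with t ⟨ht, hts, hPt⟩
    gcongr
    exact hPmono t ht hts hxy
  · refine tendsto_nhds_unique (hh (-1)) (squeeze_zero_norm' ?_ (hinv (1 - s⁻¹)⁻¹))
    filter_upwards [hI] with t ⟨ht, hts, hPt⟩
    rw [Real.norm_of_nonneg (div_nonneg (hPnn t ht _) hPt.le)]
    gcongr
    refine le_trans ?_ (hbound t ht hts)
    rw [← tsum_geometric_of_lt_one ht.le (hts.trans hs1)]
    refine (hsumm t ht hts (-1)).tsum_le_tsum (fun n => ?_)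
      (summable_geometric_of_lt_one ht.le (hts.trans hs1))
    exact mul_le_of_le_one_left (by positivity) (preimCount_neg_one_le n)
  · refine tendsto_nhds_unique (hh 1) (tendsto_const_nhds.congr' ?_)
    filter_upwards [hI] with t ht
    rw [div_self ht.2.2.ne']
  · refine hscale x y (g x) (g y) fun n => ?_
    rw [hg.preimCount_succ_sub_of_mono n hx hy hxy hm, sub_self, abs_zero]
    exact zero_le_one
  · exact hscale x y (g y) (g x) fun n => hg.preimCount_succ_sub_of_anti n hx hy hxy hm

end PiecewiseStrictMono

theorem exists_castSucc_le_lt_succ {n : ℕ} {c : Fin (n + 2) → ℝ} {x : ℝ} (h0 : c 0 ≤ x)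
    (hlast : x < c (Fin.last (n + 1))) :
    ∃ i : Fin (n + 1), c i.castSucc ≤ x ∧ x < c i.succ := by
  by_contra! hcon
  exact hlast.not_ge (Fin.induction (motive := fun j => c j ≤ x) h0 (fun i hi => hcon i hi) _)

theorem monotoneOn_Icc_of_pieces {n : ℕ} {c : Fin (n + 1) → ℝ} (hc : Monotone c) {F : ℝ → ℝ}
    (hF : ∀ i : Fin n, MonotoneOn F (Icc (c i.castSucc) (c i.succ))) :
    MonotoneOn F (Icc (c 0) (c (Fin.last n))) := by
  refine Fin.induction (motive := fun j => MonotoneOn F (Icc (c 0) (c j))) ?_ (fun i hi => ?_) _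
  · simp
  · have h1 : c 0 ≤ c i.castSucc := hc (Fin.zero_le _)
    have h2 : c i.castSucc ≤ c i.succ := hc i.castSucc_le_succ
    rw [← Icc_union_Icc_eq_Icc h1 h2]
    exact hi.union_right (hF i) (isGreatest_Icc h1) (isLeast_Icc h2)

namespace PiecewiseStrictMono

variable {g : ℝ → ℝ} {C : Finset ℝ}

/-- A monotone function expanded by a factor `s > 1` on every interval of monotonicity is
continuous. -/
theorem continuousOn_of_scaling (hg : PiecewiseStrictMono g C) {s : ℝ} (hs : 1 < s) {h : ℝ → ℝ}
    (hmono : Monotone h) (h0 : h (-1) = 0) (h1 : h 1 = 1)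
    (hup : ∀ x ∈ Icc (-1 : ℝ) 1, ∀ y ∈ Icc (-1 : ℝ) 1, x ≤ y → StrictMonoOn g (Icc x y) →
      h (g y) - h (g x) = s * (h y - h x))
    (hdown : ∀ x ∈ Icc (-1 : ℝ) 1, ∀ y ∈ Icc (-1 : ℝ) 1, x ≤ y → StrictAntiOn g (Icc x y) →
      h (g x) - h (g y) = s * (h y - h x)) :
    ContinuousOn h (Icc (-1) 1) := by
  have hs0 : 0 < s := one_pos.trans hs
  have habs_le : ∀ u ∈ Icc (-1 : ℝ) 1, ∀ v ∈ Icc (-1 : ℝ) 1, u ≤ v →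
      (StrictMonoOn g (Icc u v) ∨ StrictAntiOn g (Icc u v)) →
      |h (g v) - h (g u)| = s * |h v - h u| := by
    intro u hu v hv huv hst
    have h2 : 0 ≤ h v - h u := sub_nonneg.2 (hmono huv)
    rw [abs_of_nonneg h2]
    rcases hst with hst | hst
    · rw [hup u hu v hv huv hst, abs_of_nonneg (by positivity)]
    · rw [abs_sub_comm, hdown u hu v hv huv hst, abs_of_nonneg (by positivity)]
  have habs : ∀ u ∈ Icc (-1 : ℝ) 1, ∀ v ∈ Icc (-1 : ℝ) 1,
      (StrictMonoOn g (uIcc u v) ∨ StrictAntiOn g (uIcc u v)) →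
      |h (g v) - h (g u)| = s * |h v - h u| := by
    intro u hu v hv hst
    rcases le_total u v with huv | huv
    · rw [uIcc_of_le huv] at hst
      exact habs_le u hu v hv huv hst
    · rw [uIcc_of_ge huv] at hst
      rw [abs_sub_comm, abs_sub_comm (h v)]
      exact habs_le v hv u hu huv hst
  have hiter : ∀ n : ℕ, ∀ x ∈ Icc (-1 : ℝ) 1, ∀ y ∈ Icc (-1 : ℝ) 1, x < y →
      (∀ z ∈ Ioo x y, z ∉ hitSet g C n) →
      |h (g^[n] y) - h (g^[n] x)| = s ^ n * |h y - h x| := by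
    intro n x hx y hy hxy
    have hsub : Icc x y ⊆ Icc (-1) 1 := Icc_subset_Icc hx.1 hy.2
    induction n with
    | zero => simp
    | succ n ih =>
      intro hz
      have hz' : ∀ z ∈ Ioo x y, z ∉ hitSet g C n := fun z hzI hzn =>
        hz z hzI (hitSet_mono g C n.le_succ hzn)
      rw [Function.iterate_succ_apply', Function.iterate_succ_apply',
        habs _ (hg.iterate_mem n hx) _ (hg.iterate_mem n hy), ih hz', pow_succ']
      · ring
      · exact hg.strict_uIcc hxy ((hg.continuousOn_iterate n).mono hsub)
          (fun z hz => hg.iterate_mem n (hsub hz)) (hg.iterate_strict n hx hy hxy hz')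
          fun z hzI hzC => hz z hzI ⟨hsub (Ioo_subset_Icc_self hzI), n, n.lt_succ_self, hzC⟩
  have hsmall : ∀ n : ℕ, ∀ x ∈ Icc (-1 : ℝ) 1, ∀ y ∈ Icc (-1 : ℝ) 1, x < y →
      (∀ z ∈ Ioo x y, z ∉ hitSet g C n) → |h y - h x| ≤ s⁻¹ ^ n := by
    intro n x hx y hy hxy hz
    have h2 := hiter n x hx y hy hxy hz
    have hy' := hg.iterate_mem n hy
    have hx' := hg.iterate_mem n hx
    have h3 : |h (g^[n] y) - h (g^[n] x)| ≤ 1 := by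
      rw [abs_le]
      constructor <;> linarith [hmono hy'.1, hmono hy'.2, hmono hx'.1, hmono hx'.2]
    rw [h2] at h3
    rw [inv_pow]
    exact (le_inv_mul_iff₀ (by positivity)).2 h3 |>.trans_eq (mul_one _)
  rw [Metric.continuousOn_iff]
  intro x hx ε hε
  obtain ⟨n, hn⟩ := exists_pow_lt_of_lt_one hε (inv_lt_one_of_one_lt₀ hs)
  have hnhds : (hitSet g C n \ {x})ᶜ ∈ 𝓝 x :=
    ((hg.hitSet_finite n).sdiff).isClosed.isOpen_compl.mem_nhds (by simp)
  obtain ⟨δ, hδ, hball⟩ := Metric.mem_nhds_iff.1 hnhds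
  refine ⟨δ, hδ, fun y hy hyx => ?_⟩
  rw [Real.dist_eq, abs_lt] at hyx
  have hfree : ∀ z, |z - x| < δ → z ≠ x → z ∉ hitSet g C n := fun z hz hne hzn =>
    hball (Metric.mem_ball.2 hz) ⟨hzn, hne⟩
  rw [Real.dist_eq]
  rcases lt_trichotomy x y with hxy | rfl | hxy
  · refine (hsmall n x hx y hy hxy fun z hz => hfree z ?_ hz.1.ne').trans_lt hn
    rw [abs_lt]
    constructor <;> linarith [hz.1, hz.2]
  · simpa using hε
  · rw [abs_sub_comm]
    refine (hsmall n y hy x hx hxy fun z hz => hfree z ?_ hz.2.ne).trans_lt hn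
    rw [abs_lt]
    constructor <;> linarith [hz.1, hz.2]

/-- The normalised semiconjugacy onto `[-1,1]`. -/
theorem exists_semiconjugacy (hg : PiecewiseStrictMono g C) {s : ℝ} (hs : 1 < s)
    (hent : Dynamics.coverEntropy g (Icc (-1) 1) = (Real.log s : EReal)) :
    ∃ H : ℝ → ℝ, ContinuousOn H (Icc (-1) 1) ∧ Monotone H ∧ H (-1) = -1 ∧ H 1 = 1 ∧
      (∀ x ∈ Icc (-1 : ℝ) 1, ∀ y ∈ Icc (-1 : ℝ) 1, x ≤ y → StrictMonoOn g (Icc x y) →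
        H (g y) - H (g x) = s * (H y - H x)) ∧
      (∀ x ∈ Icc (-1 : ℝ) 1, ∀ y ∈ Icc (-1 : ℝ) 1, x ≤ y → StrictAntiOn g (Icc x y) →
        H (g x) - H (g y) = s * (H y - H x)) := by
  obtain ⟨h, hmono, h0, h1, hup, hdown⟩ := hg.exists_monotone_scaling hs hent
  have hc := hg.continuousOn_of_scaling hs hmono h0 h1 hup hdown
  refine ⟨fun x => 2 * h x - 1, (hc.const_mul 2).sub continuousOn_const, fun x y hxy => ?_, ?_, ?_,
    fun x hx y hy hxy hm => ?_, fun x hx y hy hxy hm => ?_⟩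
  · have := hmono hxy
    dsimp only
    linarith
  · norm_num [h0]
  · norm_num [h1]
  · linear_combination 2 * hup x hx y hy hxy hm
  · linear_combination 2 * hdown x hx y hy hxy hm

end PiecewiseStrictMono

/-- The values of a monotone `H` at the points of a partition, enumerated increasingly, form a
partition each of whose pieces lies in the image of a single piece. -/
theorem exists_partition_of_monotone {b : ℕ} {c : Fin (b + 2) → ℝ} {H : ℝ → ℝ}
    (hHc : Monotone fun i => H (c i)) (h0 : H (c 0) = -1) (h1 : H (c (Fin.last (b + 1))) = 1) :
    ∃ m ≤ b, ∃ d : Fin (m + 2) → ℝ, StrictMono d ∧ d 0 = -1 ∧ d (Fin.last (m + 1)) = 1 ∧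
      ∀ i : Fin (m + 1), ∃ j : Fin (b + 1),
        H (c j.castSucc) ≤ d i.castSucc ∧ d i.succ ≤ H (c j.succ) := by
  classical
  set V : Finset ℝ := Finset.univ.image fun i => H (c i) with hV
  have hmem : ∀ i, H (c i) ∈ V := fun i => Finset.mem_image_of_mem _ (Finset.mem_univ i)
  have hVI : ∀ v ∈ V, -1 ≤ v ∧ v ≤ 1 := by
    intro v hv
    obtain ⟨i, -, rfl⟩ := Finset.mem_image.1 hv
    exact ⟨h0 ▸ hHc (Fin.zero_le i), h1 ▸ hHc (Fin.le_last i)⟩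
  have hcard_le : V.card ≤ b + 2 := by
    simpa using Finset.card_image_le (s := Finset.univ) (f := fun i => H (c i))
  have hcard_gt : 1 < V.card := by
    refine Finset.one_lt_card.2 ⟨-1, h0 ▸ hmem _, 1, h1 ▸ hmem _, by norm_num⟩
  obtain ⟨m, hm⟩ : ∃ m, V.card = m + 2 := ⟨V.card - 2, by omega⟩
  set d := V.orderEmbOfFin hm with hd
  have hdV : ∀ i, d i ∈ V := fun i => V.orderEmbOfFin_mem hm i
  have hVd : ∀ v ∈ V, ∃ i, d i = v := by
    intro v hv
    have : v ∈ Set.range d := by rw [hd, Finset.range_orderEmbOfFin]; exact hv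
    exact this
  have hd0 : d 0 = -1 := by
    obtain ⟨k, hk⟩ := hVd (-1) (h0 ▸ hmem _)
    exact le_antisymm (hk ▸ d.monotone (Fin.zero_le k)) (hVI _ (hdV 0)).1
  have hdlast : d (Fin.last (m + 1)) = 1 := by
    obtain ⟨k, hk⟩ := hVd 1 (h1 ▸ hmem _)
    exact le_antisymm (hVI _ (hdV _)).2 (hk ▸ d.monotone (Fin.le_last k))
  refine ⟨m, by omega, d, d.strictMono, hd0, hdlast, fun i => ?_⟩
  have hlt : d i.castSucc < d i.succ := d.strictMono i.castSucc_lt_succ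
  obtain ⟨j, hj1, hj2⟩ := exists_castSucc_le_lt_succ (c := fun i => H (c i)) (x := d i.castSucc)
    (h0.trans_le (hVI _ (hdV _)).1) ((hlt.trans_le (hVI _ (hdV _)).2).trans_eq h1.symm)
  obtain ⟨k, hk⟩ := hVd _ (hmem j.succ)
  refine ⟨j, hj1, ?_⟩
  rw [← hk] at hj2 ⊢
  exact d.monotone (Fin.castSucc_lt_iff_succ_le.1 (d.lt_iff_lt.1 hj2))

/-- Milnor–Thurston / Parry: a continuous `b`-modal map `g` of `[-1,1]` with
`h_top(g) = log s > 0` is semi-conjugate, via a continuous monotone non-decreasing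
surjection `H`, to a piecewise linear map `f` of `[-1,1]` with at most `b' ≤ b`
turning points and constant slope `±s`. -/
theorem milnor_thurston_semiconjugacy (b : ℕ) (hb : 1 ≤ b) (g : ℝ → ℝ)
    (hgc : ContinuousOn g (Set.Icc (-1) 1))
    (hgm : Set.MapsTo g (Set.Icc (-1) 1) (Set.Icc (-1) 1))
    (hbm : BModal b g) (s : ℝ) (hs : 1 < s)
    (hent : htop g = ((Real.log s : ℝ) : EReal)) :
    ∃ b' : ℕ, b' ≤ b ∧ ∃ f : ℝ → ℝ, ∃ m : ℕ, m ≤ b' ∧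
      (∃ d : Fin (m + 2) → ℝ, StrictMono d ∧ d 0 = -1 ∧ d (Fin.last (m + 1)) = 1 ∧
        ∀ i : Fin (m + 1), ∃ q : ℝ,
          (∀ x ∈ Set.Icc (d i.castSucc) (d i.succ), f x = s * x + q) ∨
          (∀ x ∈ Set.Icc (d i.castSucc) (d i.succ), f x = -s * x + q)) ∧
      Set.MapsTo f (Set.Icc (-1) 1) (Set.Icc (-1) 1) ∧
      ∃ H : ℝ → ℝ, ContinuousOn H (Set.Icc (-1) 1) ∧ MonotoneOn H (Set.Icc (-1) 1) ∧
        H '' Set.Icc (-1) 1 = Set.Icc (-1) 1 ∧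
        ∀ x ∈ Set.Icc (-1) 1, H (g x) = f (H x) := by
  classical
  obtain ⟨c, hc, hc0, hc1, σ, hσ⟩ := hbm
  have hlap : ∀ i : Fin (b + 1), StrictMonoOn g (Icc (c i.castSucc) (c i.succ)) ∨
      StrictAntiOn g (Icc (c i.castSucc) (c i.succ)) := fun i => by
    by_cases h : Even (i : ℕ) ↔ σ = true
    exacts [Or.inl ((hσ i).1 h), Or.inr ((hσ i).2 h)]
  have hcI : ∀ i, c i ∈ Icc (-1 : ℝ) 1 := fun i =>
    ⟨hc0 ▸ hc.monotone (Fin.zero_le i), hc1 ▸ hc.monotone (Fin.le_last i)⟩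
  have hlapI : ∀ i : Fin (b + 1), Icc (c i.castSucc) (c i.succ) ⊆ Icc (-1) 1 := fun i =>
    Icc_subset_Icc (hcI _).1 (hcI _).2
  have hlapne : ∀ i : Fin (b + 1), c i.castSucc ≤ c i.succ := fun i =>
    hc.monotone i.castSucc_le_succ
  have hg : PiecewiseStrictMono g (Finset.univ.image c) := by
    refine ⟨hgc, hgm, fun x hx y hy hxy hfree => ?_⟩
    obtain ⟨i, hi1, hi2⟩ := exists_castSucc_le_lt_succ (c := c) (x := x) (hc0 ▸ hx.1)
      (hc1 ▸ hxy.trans_le hy.2)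
    have hi3 : y ≤ c i.succ := by
      by_contra! hlt
      exact hfree _ ⟨hi2, hlt⟩ (Finset.mem_image_of_mem c (Finset.mem_univ _))
    have hsub := Icc_subset_Icc hi1 hi3
    exact (hlap i).imp (fun h => h.mono hsub) fun h => h.mono hsub
  obtain ⟨H, hHc, hHm, hH0, hH1, hup, hdown⟩ := hg.exists_semiconjugacy hs hent
  have hHI : MapsTo H (Icc (-1) 1) (Icc (-1) 1) := fun x hx =>
    ⟨hH0 ▸ hHm hx.1, hH1 ▸ hHm hx.2⟩
  have himage : H '' Icc (-1) 1 = Icc (-1) 1 := by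
    refine hHI.image_subset.antisymm ?_
    have := intermediate_value_Icc (show (-1 : ℝ) ≤ 1 by norm_num) hHc
    rwa [hH0, hH1] at this
  have hglue : ∀ F : ℝ → ℝ, (∀ i : Fin (b + 1), MonotoneOn F (Icc (c i.castSucc) (c i.succ))) →
      MonotoneOn F (Icc (-1) 1) := fun F hF => by
    have := monotoneOn_Icc_of_pieces hc.monotone hF
    rwa [hc0, hc1] at this
  have hdiff : ∀ i : Fin (b + 1), ∀ x ∈ Icc (c i.castSucc) (c i.succ),
      ∀ y ∈ Icc (c i.castSucc) (c i.succ), x ≤ y →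
      |H (g y) - H (g x)| = s * (H y - H x) := by
    intro i x hx y hy hxy
    have hnn : 0 ≤ s * (H y - H x) := mul_nonneg (by linarith) (sub_nonneg.2 (hHm hxy))
    have hsub := Icc_subset_Icc hx.1 hy.2
    rcases hlap i with h | h
    · rw [hup x (hlapI i hx) y (hlapI i hy) hxy (h.mono hsub), abs_of_nonneg hnn]
    · rw [abs_sub_comm, hdown x (hlapI i hx) y (hlapI i hy) hxy (h.mono hsub),
        abs_of_nonneg hnn]
  have hwd_le : ∀ x ∈ Icc (-1 : ℝ) 1, ∀ y ∈ Icc (-1 : ℝ) 1, x ≤ y → H x = H y →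
      H (g x) = H (g y) := by
    intro x hx y hy hxy heq
    have h1 := hglue (fun z => s * H z + H (g z)) (fun i u hu v hv huv => by
      have := (abs_le.1 (hdiff i u hu v hv huv).le).1
      dsimp only
      linarith) hx hy hxy
    have h2 := hglue (fun z => s * H z - H (g z)) (fun i u hu v hv huv => by
      have := (abs_le.1 (hdiff i u hu v hv huv).le).2
      dsimp only
      linarith) hx hy hxy
    dsimp only at h1 h2
    rw [heq] at h1 h2
    linarith
  have hwd : ∀ x ∈ Icc (-1 : ℝ) 1, ∀ y ∈ Icc (-1 : ℝ) 1, H x = H y → H (g x) = H (g y) := by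
    intro x hx y hy heq
    rcases le_total x y with h | h
    · exact hwd_le x hx y hy h heq
    · exact (hwd_le y hy x hx h heq.symm).symm
  have hsurj : ∀ u ∈ Icc (-1 : ℝ) 1, ∃ x ∈ Icc (-1 : ℝ) 1, H x = u := fun u hu => by
    rwa [← himage] at hu
  choose! r hrI hr using hsurj
  have hconj : ∀ x ∈ Icc (-1 : ℝ) 1, H (g x) = H (g (r (H x))) := fun x hx =>
    hwd x hx _ (hrI _ (hHI hx)) (hr _ (hHI hx)).symm
  obtain ⟨m, hmb, d, hd, hd0, hd1, hdj⟩ := exists_partition_of_monotone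
    (fun i j hij => hHm (hc.monotone hij)) (by rw [hc0, hH0]) (by rw [hc1, hH1])
  refine ⟨b, le_rfl, fun u => H (g (r u)), m, hmb, ⟨d, hd, hd0, hd1, fun i => ?_⟩,
    fun u hu => hHI (hgm (hrI u hu)), H, hHc, hHm.monotoneOn _, himage, hconj⟩
  obtain ⟨j, hj1, hj2⟩ := hdj i
  have hlift : ∀ u ∈ Icc (d i.castSucc) (d i.succ),
      ∃ x ∈ Icc (c j.castSucc) (c j.succ), H x = u := fun u hu =>
    intermediate_value_Icc (hlapne j) (hHc.mono (hlapI j)) ⟨hj1.trans hu.1, hu.2.trans hj2⟩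
  have hleft := left_mem_Icc.2 (hlapne j)
  rcases hlap j with h | h
  · refine ⟨H (g (c j.castSucc)) - s * H (c j.castSucc), Or.inl fun u hu => ?_⟩
    obtain ⟨x, hx, rfl⟩ := hlift u hu
    show H (g (r (H x))) = _
    rw [← hconj x (hlapI j hx)]
    linear_combination hup _ (hlapI j hleft) x (hlapI j hx) hx.1
      (h.mono (Icc_subset_Icc_right hx.2))
  · refine ⟨H (g (c j.castSucc)) + s * H (c j.castSucc), Or.inr fun u hu => ?_⟩
    obtain ⟨x, hx, rfl⟩ := hlift u hu
    show H (g (r (H x))) = _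
    rw [← hconj x (hlapI j hx)]
    linear_combination -hdown _ (hlapI j hleft) x (hlapI j hx) hx.1
      (h.mono (Icc_subset_Icc_right hx.2))
end

section
/- For α ∈ [1, 4], set β(α) = 2√α − α and let f_α(x) = α·x³ + β(α)·x² + (1−α)·x − β(α). Then f_α(−1) = −1, f_α(1) = 1, the critical points of f_α are c_1(α) = −(1/3)(1 + 1/√α) and c_2(α) = 1 − 1/√α, f_α(c_2(α)) = −1, the critical value at c_1 equals v_1(α) = f_α(c_1(α)) = (32/27)α − (48/27)√α − 1/9 − 4/(27√α), and moreover the functions α ↦ c_1(α), α ↦ c_2(α) and α ↦ v_1(α) are strictly increasing on [1, 4]. -/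
/-- `β(α) = 2√α - α`. -/
noncomputable def betaF (α : ℝ) : ℝ := 2 * Real.sqrt α - α

/-- The anchored cubic map `f_α(x) = α x³ + β(α) x² + (1-α) x - β(α)`. -/
noncomputable def fcub (α x : ℝ) : ℝ := α * x ^ 3 + betaF α * x ^ 2 + (1 - α) * x - betaF α

/-- `c₁(α) = -(1/3)(1 + 1/√α)`. -/
noncomputable def c1F (α : ℝ) : ℝ := -(1 / 3) * (1 + 1 / Real.sqrt α)

/-- `c₂(α) = 1 - 1/√α`. -/
noncomputable def c2F (α : ℝ) : ℝ := 1 - 1 / Real.sqrt α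

/-- `v₁(α) = (32/27)α - (48/27)√α - 1/9 - 4/(27√α)`. -/
noncomputable def v1F (α : ℝ) : ℝ :=
  (32 / 27) * α - (48 / 27) * Real.sqrt α - 1 / 9 - 4 / (27 * Real.sqrt α)

/-- The derivative of `f_α` factors through `c₁(α)` and `c₂(α)`. -/
theorem deriv_fcub {α : ℝ} (hα : 0 < α) (x : ℝ) :
    deriv (fcub α) x = 3 * α * ((x - c1F α) * (x - c2F α)) := by
  have hderiv : HasDerivAt (fcub α)
      (α * (3 * x ^ 2) + betaF α * (2 * x) + (1 - α)) x := by
    have h := ((((hasDerivAt_pow 3 x).const_mul α).add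
      ((hasDerivAt_pow 2 x).const_mul (betaF α))).add
      ((hasDerivAt_id x).const_mul (1 - α))).sub_const (betaF α)
    exact HasDerivAt.congr_deriv h (by norm_num)
  rw [hderiv.deriv]
  obtain ⟨s, hs, rfl⟩ : ∃ s : ℝ, 0 < s ∧ α = s ^ 2 :=
    ⟨√α, Real.sqrt_pos.2 hα, (Real.sq_sqrt hα.le).symm⟩
  simp only [betaF, c1F, c2F, Real.sqrt_sq hs.le]
  field_simp
  ring

theorem fcub_c2F {α : ℝ} (hα : 0 < α) : fcub α (c2F α) = -1 := by
  obtain ⟨s, hs, rfl⟩ : ∃ s : ℝ, 0 < s ∧ α = s ^ 2 :=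
    ⟨√α, Real.sqrt_pos.2 hα, (Real.sq_sqrt hα.le).symm⟩
  simp only [fcub, betaF, c2F, Real.sqrt_sq hs.le]
  field_simp
  ring

theorem fcub_c1F {α : ℝ} (hα : 0 < α) : fcub α (c1F α) = v1F α := by
  obtain ⟨s, hs, rfl⟩ : ∃ s : ℝ, 0 < s ∧ α = s ^ 2 :=
    ⟨√α, Real.sqrt_pos.2 hα, (Real.sq_sqrt hα.le).symm⟩
  simp only [fcub, betaF, c1F, v1F, Real.sqrt_sq hs.le]
  field_simp
  ring

theorem one_div_sqrt_lt {a b : ℝ} (ha : 0 < a) (hab : a < b) : 1 / √b < 1 / √a :=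
  one_div_lt_one_div_of_lt (Real.sqrt_pos.2 ha) (Real.sqrt_lt_sqrt ha.le hab)

theorem v1F_lt_v1F {a b : ℝ} (ha : 1 ≤ a) (hab : a < b) : v1F a < v1F b := by
  have ha0 : 0 < a := by linarith
  have hinv := one_div_sqrt_lt ha0 hab
  have hs : 1 ≤ √a := Real.one_le_sqrt.2 ha
  have hst : √a < √b := Real.sqrt_lt_sqrt ha0.le hab
  have key : 48 * (√b - √a) < 32 * (b - a) := by
    nlinarith [Real.sq_sqrt ha0.le, Real.sq_sqrt (ha0.trans hab).le]
  have hdiv (t : ℝ) : 4 / (27 * t) = 4 / 27 * (1 / t) := by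
    rw [div_mul_div_comm, mul_one]
  simp only [v1F, hdiv]
  linarith

/-- Facts about the anchored cubic family `f_α` for `α ∈ [1,4]`:
`f_α(-1) = -1`, `f_α(1) = 1`, the critical points of `f_α` are exactly `c₁(α)` and
`c₂(α)`, `f_α(c₂(α)) = -1`, `f_α(c₁(α)) = v₁(α)`, and `c₁`, `c₂`, `v₁` are strictly
increasing on `[1,4]`. -/
theorem anchored_cubic_family_facts :
    (∀ α ∈ Set.Icc (1 : ℝ) 4,
      fcub α (-1) = -1 ∧ fcub α 1 = 1 ∧
      (∀ x : ℝ, deriv (fcub α) x = 0 ↔ x = c1F α ∨ x = c2F α) ∧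
      fcub α (c2F α) = -1 ∧ fcub α (c1F α) = v1F α) ∧
    StrictMonoOn c1F (Set.Icc (1 : ℝ) 4) ∧
    StrictMonoOn c2F (Set.Icc (1 : ℝ) 4) ∧
    StrictMonoOn v1F (Set.Icc (1 : ℝ) 4) := by
  refine ⟨fun α hα => ?_, fun a ha b _ hab => ?_, fun a ha b _ hab => ?_,
    fun a ha b _ hab => v1F_lt_v1F ha.1 hab⟩
  · have hα0 : 0 < α := zero_lt_one.trans_le hα.1
    refine ⟨by simp only [fcub]; ring, by simp only [fcub]; ring, fun x => ?_,
      fcub_c2F hα0, fcub_c1F hα0⟩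
    rw [deriv_fcub hα0, mul_eq_zero_iff_left (by positivity), mul_eq_zero, sub_eq_zero,
      sub_eq_zero]
  · have := one_div_sqrt_lt (zero_lt_one.trans_le ha.1) hab
    simp only [c1F]
    linarith
  · have := one_div_sqrt_lt (zero_lt_one.trans_le ha.1) hab
    simp only [c2F]
    linarith
end
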